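/- arXiv:1506.05770 — 3 statements merged into one kernel-verified Lean document; each statement's English description precedes it below -/
import Mathlib

section
/- Let (Ā, B̄) be the structural pair composed of r similar subsystems parametrized by (Ā', B̄', H̄, Ē). Assume that (Ā', B̄') is not structurally controllable and that the system bipartite graph B(Ā', B̄') has a matching with no right-unmatched vertices. Then (Ā, B̄) is structurally controllable if and only if (Ā' ∨ H̄, B̄') is structurally controllable and the condensed graph D(Ē) has no source, i.e., for every i ∈ {1,…,r} there exists j with Ē_{ij} = 1. -/
open Matrix

/-- Controllability matrix `[B, AB, …, A^{n-1}B]` (columns indexed by `Fin (card X) × U`). -/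
def ctrbMatrix {X U : Type*} [Fintype X] [DecidableEq X]
    (A : Matrix X X ℝ) (B : Matrix X U ℝ) :
    Matrix X (Fin (Fintype.card X) × U) ℝ :=
  fun i kj => (A ^ (kj.1 : ℕ) * B) i kj.2

/-- A real pair `(A,B)` is controllable if its controllability matrix has full rank. -/
def Controllable {X U : Type*} [Fintype X] [DecidableEq X] [Fintype U]
    (A : Matrix X X ℝ) (B : Matrix X U ℝ) : Prop :=
  (ctrbMatrix A B).rank = Fintype.card X

/-- `M` has the same sparsity pattern as the Boolean matrix `Mb`. -/
def SameSparsity {X Y : Type*} (M : Matrix X Y ℝ) (Mb : Matrix X Y Bool) : Prop :=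
  ∀ i j, M i j = 0 ↔ Mb i j = false

/-- Structural controllability of a structural (Boolean) pair. -/
def StructurallyControllable {X U : Type*} [Fintype X] [DecidableEq X] [Fintype U]
    (Ab : Matrix X X Bool) (Bb : Matrix X U Bool) : Prop :=
  ∃ A : Matrix X X ℝ, ∃ B : Matrix X U ℝ,
    SameSparsity A Ab ∧ SameSparsity B Bb ∧ Controllable A B

/-- Edge relation of the system digraph `D(Ā,B̄)`. -/
def sysDigraphRel {X U : Type*} (Ab : Matrix X X Bool) (Bb : Matrix X U Bool) :
    (X ⊕ U) → (X ⊕ U) → Prop :=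
  fun v w => match v, w with
  | Sum.inl j, Sum.inl i => Ab i j = true
  | Sum.inr k, Sum.inl i => Bb i k = true
  | _, Sum.inr _ => False

/-- A state vertex is input-reachable if some input vertex has a directed path to it. -/
def InputReachable {X U : Type*} (Ab : Matrix X X Bool) (Bb : Matrix X U Bool) (x : X) : Prop :=
  ∃ u : U, Relation.ReflTransGen (sysDigraphRel Ab Bb) (Sum.inr u) (Sum.inl x)

/-- Edge relation of the system bipartite graph `B(Ā,B̄)` (left = states ⊕ inputs, right = states). -/
def sysBipEdge {X U : Type*} (Ab : Matrix X X Bool) (Bb : Matrix X U Bool) :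
    (X ⊕ U) → X → Prop :=
  fun v i => match v with
  | Sum.inl j => Ab i j = true
  | Sum.inr k => Bb i k = true

/-- Edge relation of the state bipartite graph `B(Ā)`. -/
def stateBipEdge {X : Type*} (Ab : Matrix X X Bool) : X → X → Prop :=
  fun j i => Ab i j = true

/-- A matching of a bipartite graph with edge relation `E`: a set of edges sharing no
left vertex and no right vertex. -/
def IsMatching {α β : Type*} (E : α → β → Prop) (M : Set (α × β)) : Prop :=
  (∀ e ∈ M, E e.1 e.2) ∧
  (∀ e ∈ M, ∀ f ∈ M, e.1 = f.1 → e = f) ∧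
  (∀ e ∈ M, ∀ f ∈ M, e.2 = f.2 → e = f)

/-- Right vertices belonging to no edge of `M`. -/
def rightUnmatched {α β : Type*} (M : Set (α × β)) : Set β :=
  {b | ∀ e ∈ M, e.2 ≠ b}

/-- Left vertices belonging to no edge of `M`. -/
def leftUnmatched {α β : Type*} (M : Set (α × β)) : Set α :=
  {a | ∀ e ∈ M, e.1 ≠ a}

/-- A maximum matching: a matching of the largest cardinality. -/
def IsMaxMatching {α β : Type*} (E : α → β → Prop) (M : Set (α × β)) : Prop :=
  IsMatching E M ∧ ∀ M' : Set (α × β), IsMatching E M' → M'.ncard ≤ M.ncard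

/-- `S` is a strongly connected component of the digraph with edge relation `R`. -/
def IsSCC {V : Type*} (R : V → V → Prop) (S : Set V) : Prop :=
  S.Nonempty ∧ (∀ u ∈ S, ∀ v ∈ S, Relation.ReflTransGen R u v) ∧
  ∀ w : V, (∀ u ∈ S, Relation.ReflTransGen R u w ∧ Relation.ReflTransGen R w u) → w ∈ S

/-- An SCC is non-top linked if it has no incoming edge from outside. -/
def NonTopLinked {V : Type*} (R : V → V → Prop) (S : Set V) : Prop :=
  ∀ u v : V, R u v → v ∈ S → u ∈ S

/-- Dynamics pattern `(I_r ⊗ Ā') ∨ (Ē ⊗ H̄)` of a system of `r` similar subsystems. -/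
def simA {n : ℕ} (r : ℕ) (A' H : Matrix (Fin n) (Fin n) Bool)
    (E : Matrix (Fin r) (Fin r) Bool) :
    Matrix (Fin r × Fin n) (Fin r × Fin n) Bool :=
  fun q q' => ((if q.1 = q'.1 then A' q.2 q'.2 else false) || (E q.1 q'.1 && H q.2 q'.2))

/-- Input pattern `I_r ⊗ B̄'` of a system of `r` similar subsystems. -/
def simB {n p : ℕ} (r : ℕ) (B' : Matrix (Fin n) (Fin p) Bool) :
    Matrix (Fin r × Fin n) (Fin r × Fin p) Bool :=
  fun q k => if q.1 = k.1 then B' q.2 k.2 else false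

/-- Entrywise OR of Boolean matrices. -/
def orMat {X Y : Type*} (M N : Matrix X Y Bool) : Matrix X Y Bool :=
  fun i j => M i j || N i j

/-- Dynamics pattern of an interconnected system: diagonal blocks `Ā_i`,
off-diagonal blocks `Ē_{i,j}`. -/
def interA {r : ℕ} {n : Fin r → ℕ}
    (A : ∀ i, Matrix (Fin (n i)) (Fin (n i)) Bool)
    (E : ∀ i j, Matrix (Fin (n i)) (Fin (n j)) Bool) :
    Matrix (Σ i, Fin (n i)) (Σ i, Fin (n i)) Bool :=
  fun q q' => if h : q'.1 = q.1 then A q.1 q.2 (h ▸ q'.2) else E q.1 q'.1 q.2 q'.2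

/-- Input pattern of an interconnected system: block diagonal with blocks `B̄_i`. -/
def interB {r : ℕ} {n p : Fin r → ℕ}
    (B : ∀ i, Matrix (Fin (n i)) (Fin (p i)) Bool) :
    Matrix (Σ i, Fin (n i)) (Σ i, Fin (p i)) Bool :=
  fun q k => if h : k.1 = q.1 then B q.1 q.2 (h ▸ k.2) else false

theorem Lin.row_zero {Z : Type*} [Fintype Z] [DecidableEq Z] (D : Finset Z) (A : Matrix Z Z ℝ)
    (hA : ∀ i j, A i j ≠ 0 → i ∈ D) (i : ℕ) (z u : Z) (hz : z ∉ D) (hu : u ∈ D) :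
    (A ^ i) z u = 0 := by
  cases i with
  | zero =>
    have : z ≠ u := fun h => hz (h ▸ hu)
    simp [this]
  | succ i =>
    rw [pow_succ', Matrix.mul_apply]
    refine Finset.sum_eq_zero fun j _ => ?_
    have : A z j = 0 := by
      by_contra h
      exact hz (hA z j h)
    rw [this, zero_mul]

theorem Lin.cycle_ext {Z : Type*} [Fintype Z] [DecidableEq Z] (U : Set Z) (m : Z → Z)
    (D C : Finset Z) (hUD : ∀ u ∈ U, u ∈ D) (hCD : ∀ c ∈ C, c ∉ D)
    (x y : Z) (hx : x ∈ C) (hy : y ∈ D)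
    (hmC : ∀ c ∈ C, m c ∈ C) (hinj : ∀ c ∈ C, ∀ c' ∈ C, m c = m c' → c = c')
    (l : ℕ) (hl : 0 < l) (hper : ∀ c ∈ C, m^[l] c = c) (htr : ∀ c ∈ C, ∃ j, m^[j] c = x)
    (A : Matrix Z Z ℝ) (hAD : ∀ i j, A i j ≠ 0 → i ∈ D ∧ j ∈ D)
    (hN : ∀ v : Z → ℝ, (∀ k : ℕ, ∀ u ∈ U, (v ᵥ* A ^ k) u = 0) → ∀ d ∈ D, v d = 0) :
    ∃ A2 : Matrix Z Z ℝ,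
      (∀ i j, A2 i j ≠ 0 → A i j ≠ 0 ∨ (i = x ∧ j = y) ∨ (i ∈ C ∧ j = m i)) ∧
      (∀ v : Z → ℝ, (∀ k : ℕ, ∀ u ∈ U, (v ᵥ* A2 ^ k) u = 0) →
        ∀ d, d ∈ D ∨ d ∈ C → v d = 0) := by
  classical
  -- reachability of y
  have hreach : ∃ k, ∃ u ∈ U, (A ^ k) y u ≠ 0 := by
    by_contra! h
    have := hN (Pi.single y 1) (fun k u hu => by simpa using h k u hu) y hy
    simp at this
  obtain ⟨u0, hu0, hmu⟩ := Nat.find_spec hreach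
  have hmin : ∀ i < Nat.find hreach, ∀ u ∈ U, (A ^ i) y u = 0 := by
    intro i hi u hu
    have := Nat.find_min hreach hi
    push Not at this
    exact this u hu
  set K := Nat.find hreach with hK
  -- bounds
  set a : ℝ := ∑ i, ∑ j, |A i j| with ha
  set b : ℝ := ∑ i, |(A ^ (K + 1)) i u0| with hb
  have ha0 : 0 ≤ a := by positivity
  have hb0 : 0 ≤ b := by positivity
  set μ := |(A ^ K) y u0| with hμ
  have hμ0 : 0 < μ := abs_pos.mpr hmu
  obtain ⟨ε, hε, hεa, hεb⟩ : ∃ ε : ℝ, 0 < ε ∧ ε * a ≤ 1 / 2 ∧ 2 * ε * b < μ := by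
    refine ⟨min (1 / (2 * (a + 1))) (μ / (2 * (b + 1))), by positivity, ?_, ?_⟩
    · calc _ ≤ (1 / (2 * (a + 1))) * a := by gcongr; exact min_le_left _ _
        _ ≤ 1 / 2 := by
          rw [div_mul_eq_mul_div, div_le_div_iff₀ (by positivity) (by positivity)]; linarith
    · calc _ ≤ 2 * (μ / (2 * (b + 1))) * b := by gcongr; exact min_le_right _ _
        _ = μ * (b / (b + 1)) := by field_simp
        _ < μ * 1 := by
          gcongr
          rw [div_lt_one (by positivity)]; linarith
        _ = μ := mul_one _
  set P : Matrix Z Z ℝ := Matrix.of fun i j => if i ∈ C ∧ j = m i then 1 else 0 with hP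
  set A2 : Matrix Z Z ℝ := ε • A + ε • Matrix.single x y (1 : ℝ) + P with hA2
  have hvP1 : ∀ (v : Z → ℝ) (z : Z), z ∉ C → (v ᵥ* P) z = 0 := by
    intro v z hz
    rw [Matrix.vecMul, dotProduct]
    refine Finset.sum_eq_zero fun i _ => ?_
    have : ¬ (i ∈ C ∧ z = m i) := fun h => hz (h.2 ▸ hmC i h.1)
    simp [hP, this]
  have hvP2 : ∀ (v : Z → ℝ), ∀ c ∈ C, (v ᵥ* P) (m c) = v c := by
    intro v c hc
    rw [Matrix.vecMul, dotProduct, Finset.sum_eq_single c]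
    · simp [hP, hc]
    · intro i _ hi
      have : ¬ (i ∈ C ∧ m c = m i) := fun h => hi (hinj i h.1 c hc h.2.symm)
      simp [hP, this]
    · simp
  have hstep : ∀ v : Z → ℝ, v ᵥ* A2 = ε • (v ᵥ* A) + (ε * v x) • Pi.single y 1 + v ᵥ* P := by
    intro v
    rw [hA2, Matrix.vecMul_add, Matrix.vecMul_add, Matrix.vecMul_smul, Matrix.vecMul_smul]
    congr 2
    rw [mul_smul]
    congr 1
    ext j
    simp [Matrix.vecMul, dotProduct, Matrix.single_apply, Pi.single_apply, ite_and, eq_comm]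
  have hpow : ∀ (v : Z → ℝ) (i : ℕ), ∀ u ∈ D, ((v ᵥ* A2) ᵥ* A ^ i) u
      = ε * (v ᵥ* A ^ (i + 1)) u + ε * v x * (A ^ i) y u := by
    intro v i u hu
    rw [hstep, Matrix.add_vecMul, Matrix.add_vecMul, Matrix.smul_vecMul, Matrix.smul_vecMul,
      Matrix.vecMul_vecMul, ← pow_succ']
    have h0 : ((v ᵥ* P) ᵥ* A ^ i) u = 0 := by
      rw [Matrix.vecMul, dotProduct]
      refine Finset.sum_eq_zero fun z _ => ?_
      by_cases hz : z ∈ C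
      · rw [Lin.row_zero D A (fun i j h => (hAD i j h).1) i z u (hCD z hz) hu, mul_zero]
      · rw [hvP1 v z hz, zero_mul]
    simpa using h0
  have hC : ∀ (v : Z → ℝ), ∀ c ∈ C, (v ᵥ* A2) (m c) = v c := by
    intro v c hc
    have h1 : m c ∉ D := hCD _ (hmC c hc)
    have h2 : (v ᵥ* A) (m c) = 0 := by
      rw [Matrix.vecMul, dotProduct]
      refine Finset.sum_eq_zero fun z _ => ?_
      have : A z (m c) = 0 := by
        by_contra h
        exact h1 (hAD _ _ h).2
      rw [this, mul_zero]
    have h3 : m c ≠ y := fun h => h1 (h ▸ hy)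
    rw [hstep]
    simp [h2, h3, hvP2 v c hc]
  have hmit : ∀ j, ∀ c ∈ C, m^[j] c ∈ C := by
    intro j
    induction j with
    | zero => simp
    | succ j ih => intro c hc; rw [Function.iterate_succ_apply]; exact ih _ (hmC c hc)
  have hCj : ∀ (j : ℕ) (v : Z → ℝ), ∀ c ∈ C, (v ᵥ* A2 ^ j) (m^[j] c) = v c := by
    intro j
    induction j with
    | zero => simp
    | succ j ih =>
      intro v c hc
      rw [pow_succ', ← Matrix.vecMul_vecMul, Function.iterate_succ_apply, ih _ _ (hmC c hc),
        hC v c hc]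
  have hCsurj : ∀ c ∈ C, ∃ c' ∈ C, m c' = c := by
    intro c hc
    refine ⟨m^[l - 1] c, hmit _ _ hc, ?_⟩
    rw [← Function.iterate_succ_apply' m, Nat.succ_eq_add_one, Nat.sub_add_cancel hl, hper c hc]
  -- vectors of N2 vanishing on C
  have hkill0 : ∀ (j i : ℕ) (v : Z → ℝ), (∀ c ∈ C, v c = 0) → ∀ u ∈ D,
      ((v ᵥ* A2 ^ j) ᵥ* A ^ i) u = ε ^ j * (v ᵥ* A ^ (j + i)) u := by
    intro j
    induction j with
    | zero => simp
    | succ j ih =>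
      intro i v hv u hu
      have hv' : ∀ c ∈ C, (v ᵥ* A2) c = 0 := by
        intro c hc
        obtain ⟨c', hc', rfl⟩ := hCsurj c hc
        rw [hC v c' hc', hv c' hc']
      rw [pow_succ', ← Matrix.vecMul_vecMul, ih i _ hv' u hu, hpow v _ u hu, hv x hx,
        show j + 1 + i = j + i + 1 by ring]
      ring
  have hkill : ∀ v : Z → ℝ, (∀ k : ℕ, ∀ u ∈ U, (v ᵥ* A2 ^ k) u = 0) → (∀ c ∈ C, v c = 0) →
      ∀ d ∈ D, v d = 0 := by
    intro v hv hvC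
    refine hN v fun k u hu => ?_
    have := hkill0 k 0 v hvC u (hUD u hu)
    rw [pow_zero, Matrix.vecMul_one, hv k u hu, add_zero] at this
    have h2 : ε ^ k ≠ 0 := by positivity
    exact (mul_eq_zero.mp this.symm).resolve_left h2
  have hinv : ∀ v : Z → ℝ, (∀ k : ℕ, ∀ u ∈ U, (v ᵥ* A2 ^ k) u = 0) → ∀ j,
      (∀ k : ℕ, ∀ u ∈ U, ((v ᵥ* A2 ^ j) ᵥ* A2 ^ k) u = 0) := by
    intro v hv j k u hu
    rw [Matrix.vecMul_vecMul, ← pow_add]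
    exact hv _ u hu
  -- periodicity
  have hperD : ∀ v : Z → ℝ, (∀ k : ℕ, ∀ u ∈ U, (v ᵥ* A2 ^ k) u = 0) →
      ∀ d ∈ D, (v ᵥ* A2 ^ l) d = v d := by
    intro v hv d hd
    have := hkill (v ᵥ* A2 ^ l - v) (fun k u hu => by
      rw [Matrix.sub_vecMul, Pi.sub_apply, hinv v hv l k u hu, hv k u hu, sub_zero])
      (fun c hc => by
        have := hCj l v c hc
        rw [hper c hc] at this
        rw [Pi.sub_apply, this, sub_self]) d hd
    rw [Pi.sub_apply] at this
    linarith
  -- small Markov parameters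
  have hs : ∀ i ≤ K, ∀ v : Z → ℝ, (∀ k : ℕ, ∀ u ∈ U, (v ᵥ* A2 ^ k) u = 0) →
      ∀ u ∈ U, (v ᵥ* A ^ i) u = 0 := by
    intro i
    induction i with
    | zero => intro _ v hv u hu; simpa using hv 0 u hu
    | succ i ih =>
      intro hi v hv u hu
      have h1 := hpow v i u (hUD u hu)
      have h2 := ih (by omega) (v ᵥ* A2) (by simpa using hinv v hv 1) u hu
      rw [h2, hmin i (by omega) u hu, mul_zero, add_zero] at h1
      exact (mul_eq_zero.mp h1.symm).resolve_left hε.ne'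
  have hkey : ∀ v : Z → ℝ, (∀ k : ℕ, ∀ u ∈ U, (v ᵥ* A2 ^ k) u = 0) →
      ∀ R : ℝ, (∀ d ∈ D, |v d| ≤ R) → |v x| * μ ≤ R * b := by
    intro v hv R hR
    have h1 := hpow v K u0 (hUD u0 hu0)
    have h2 := hs K le_rfl (v ᵥ* A2) (by simpa using hinv v hv 1) u0 hu0
    rw [h2] at h1
    have h3 : v x * (A ^ K) y u0 = - (v ᵥ* A ^ (K + 1)) u0 := by
      have : ε * (v x * (A ^ K) y u0 + (v ᵥ* A ^ (K + 1)) u0) = 0 := by linarith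
      have := (mul_eq_zero.mp this).resolve_left hε.ne'
      linarith
    rw [hμ, ← abs_mul, h3, abs_neg, Matrix.vecMul, dotProduct, hb, Finset.mul_sum]
    refine (Finset.abs_sum_le_sum_abs _ _).trans (Finset.sum_le_sum fun z _ => ?_)
    rw [abs_mul]
    by_cases hz : z ∈ D
    · gcongr; exact hR z hz
    · rw [Lin.row_zero D A (fun i j h => (hAD i j h).1) _ z u0 hz (hUD u0 hu0)]; simp
  have hgrow : ∀ v : Z → ℝ, ∀ R : ℝ, (∀ d ∈ D, |v d| ≤ R) → 0 ≤ R → ∀ d ∈ D,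
      |(v ᵥ* A2) d| ≤ ε * (R * a) + ε * |v x| := by
    intro v R hR hR0 d hd
    have h1 := hpow v 0 d hd
    rw [pow_zero, Matrix.vecMul_one, zero_add, pow_one] at h1
    rw [h1]
    refine (abs_add_le _ _).trans ?_
    have h2 : |(v ᵥ* A) d| ≤ R * a := by
      rw [Matrix.vecMul, dotProduct, ha, Finset.mul_sum]
      refine (Finset.abs_sum_le_sum_abs _ _).trans (Finset.sum_le_sum fun z _ => ?_)
      rw [abs_mul]
      by_cases hz : z ∈ D
      · have := Finset.single_le_sum (f := fun j => |A z j|) (fun j _ => abs_nonneg _)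
          (Finset.mem_univ d)
        have h3 := hR z hz
        have := abs_nonneg (A z d)
        gcongr
        
      · have : A z d = 0 := by
          by_contra h
          exact hz (hAD _ _ h).1
        rw [this]; simp; positivity
    have h3 : |(1 : Matrix Z Z ℝ) y d| ≤ 1 := by
      rw [Matrix.one_apply]; split_ifs <;> simp
    rw [abs_mul, abs_mul, abs_mul, abs_of_pos hε]
    have : ε * |v x| * |(1 : Matrix Z Z ℝ) y d| ≤ ε * |v x| * 1 := by gcongr
    have h4 : ε * |(v ᵥ* A) d| ≤ ε * (R * a) := by gcongr
    linarith
  refine ⟨A2, ?_, ?_⟩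
  · intro i j hij
    by_contra! h
    apply hij
    have h1 : A i j = 0 := h.1
    have h2 : ¬ (x = i ∧ y = j) := fun h' => h.2.1 h'.1.symm h'.2.symm
    have h3 : ¬ (i ∈ C ∧ j = m i) := fun h' => h.2.2 h'.1 h'.2
    simp [hA2, hP, h1, h3, Matrix.single_apply, h2]
  · intro v hv
    -- maximum of |v^{(j)} x|
    obtain ⟨j0, hj0, hM⟩ := Finset.exists_max_image (Finset.range l)
      (fun j => |(v ᵥ* A2 ^ j) x|) ⟨0, by simpa using hl⟩
    obtain ⟨⟨j1, d1⟩, hj1, hR⟩ := Finset.exists_max_image (Finset.range l ×ˢ D)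
      (fun q => |(v ᵥ* A2 ^ q.1) q.2|) ⟨(0, y), by simpa using ⟨hl, hy⟩⟩
    simp only [Finset.mem_product, Finset.mem_range] at hj1 hR hj0 hM
    set R := |(v ᵥ* A2 ^ j1) d1| with hRdef
    set M := |(v ᵥ* A2 ^ j0) x| with hMdef
    have hR0 : 0 ≤ R := abs_nonneg _
    have hM0 : 0 ≤ M := abs_nonneg _
    have hR' : ∀ j < l, ∀ d ∈ D, |(v ᵥ* A2 ^ j) d| ≤ R := fun j hj d hd => hR (j, d) ⟨hj, hd⟩
    have hRle : R ≤ ε * (R * a) + ε * M := by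
      obtain ⟨j2, hj2, hj2'⟩ : ∃ j2 < l, (v ᵥ* A2 ^ (j2 + 1)) d1 = (v ᵥ* A2 ^ j1) d1 := by
        rcases Nat.eq_zero_or_pos j1 with h | h
        · refine ⟨l - 1, by omega, ?_⟩
          rw [Nat.sub_add_cancel hl, hperD v hv d1 hj1.2, h]
          simp
        · exact ⟨j1 - 1, by omega, by rw [Nat.sub_add_cancel h]⟩
      have h1 := hgrow (v ᵥ* A2 ^ j2) R (hR' j2 hj2) hR0 d1 hj1.2
      rw [Matrix.vecMul_vecMul, ← pow_succ, hj2'] at h1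
      have h2 := hM j2 hj2
      have : ε * |(v ᵥ* A2 ^ j2) x| ≤ ε * M := by gcongr
      linarith
    have hR2 : R ≤ 2 * ε * M := by nlinarith
    have hMle := hkey (v ᵥ* A2 ^ j0) (hinv v hv j0) R (hR' j0 hj0)
    have hMz : M = 0 := by
      by_contra h
      have hMp : 0 < M := lt_of_le_of_ne hM0 (Ne.symm h)
      have h1 : M * μ ≤ 2 * ε * M * b := hMle.trans (by gcongr)
      have : M * (2 * ε * b) < M * μ := by gcongr
      linarith
    have hvC : ∀ c ∈ C, v c = 0 := by
      intro c hc
      obtain ⟨j, hj⟩ := htr c hc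
      have hmod : ∃ j < l, m^[j] c = x := by
        refine ⟨j % l, Nat.mod_lt _ hl, ?_⟩
        rw [← hj]
        exact (Function.IsPeriodicPt.iterate_mod_apply (hper c hc) j)
      obtain ⟨j, hjl, hj⟩ := hmod
      have h1 := hCj j v c hc
      rw [hj] at h1
      have h2 := hM j hjl
      rw [hMz, h1] at h2
      exact abs_nonpos_iff.mp h2
    rintro d (hd | hd)
    · exact hkill v hv hvC d hd
    · exact hvC d hd

theorem Lin.graph {Z : Type*} [Fintype Z] [DecidableEq Z] (U : Set Z) (m : Z → Z)
    (R : Z → Z → Prop) (hm : ∀ z, z ∉ U → R (m z) z)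
    (hinj : ∀ z, z ∉ U → ∀ w, w ∉ U → m z = m w → z = w)
    (hreach : ∀ z, ∃ u ∈ U, Relation.ReflTransGen R u z) :
    ∃ A : Matrix Z Z ℝ, (∀ i j, A i j ≠ 0 → R j i) ∧
      ∀ v : Z → ℝ, (∀ k : ℕ, ∀ u ∈ U, (v ᵥ* A ^ k) u = 0) → v = 0 := by
  classical
  suffices H : ∀ (s : ℕ) (D : Finset Z), Dᶜ.card = s → (∀ u ∈ U, u ∈ D) →
      (∀ z, z ∉ D → m z ∉ D) →
      (∃ A : Matrix Z Z ℝ, (∀ i j, A i j ≠ 0 → R j i ∧ i ∈ D ∧ j ∈ D) ∧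
        ∀ v : Z → ℝ, (∀ k : ℕ, ∀ u ∈ U, (v ᵥ* A ^ k) u = 0) → ∀ d ∈ D, v d = 0) →
      ∃ A : Matrix Z Z ℝ, (∀ i j, A i j ≠ 0 → R j i) ∧
      ∀ v : Z → ℝ, (∀ k : ℕ, ∀ u ∈ U, (v ᵥ* A ^ k) u = 0) → v = 0 by
    -- stems
    let S : ℕ → Z → Prop := fun k => Nat.rec (motive := fun _ => Z → Prop) (fun z => z ∈ U)
      (fun _ p z => p z ∨ (z ∉ U ∧ p (m z))) k
    let D : Finset Z := Finset.univ.filter fun z => ∃ k, S k z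
    have hD : ∀ z, z ∈ D ↔ ∃ k, S k z := by simp [D]
    have hUD : ∀ u ∈ U, u ∈ D := fun u hu => (hD u).2 ⟨0, hu⟩
    refine H _ D rfl hUD ?_ ?_
    · intro z hz hmz
      obtain ⟨k, hk⟩ := (hD _).1 hmz
      have hzU : z ∉ U := fun h => hz (hUD z h)
      exact hz ((hD z).2 ⟨k + 1, Or.inr ⟨hzU, hk⟩⟩)
    · let A : Matrix Z Z ℝ := Matrix.of fun i j =>
        if i ∉ U ∧ i ∈ D ∧ j ∈ D ∧ j = m i then 1 else 0
      refine ⟨A, ?_, ?_⟩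
      · intro i j hij
        have : i ∉ U ∧ i ∈ D ∧ j ∈ D ∧ j = m i := by
          by_contra h
          exact hij (by simp only [A, Matrix.of_apply, if_neg h])
        exact ⟨this.2.2.2 ▸ hm i this.1, this.2.1, this.2.2.1⟩
      · intro v hv d hd
        obtain ⟨k, hk⟩ := (hD d).1 hd
        induction k generalizing v d with
        | zero => simpa using hv 0 d hk
        | succ k ih =>
          rcases hk with hk | ⟨hdU, hk⟩
          · exact ih v hv d hd hk
          · have hmd : m d ∈ D := (hD _).2 ⟨k, hk⟩
            have h1 := ih (v ᵥ* A) (fun k u hu => by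
              rw [Matrix.vecMul_vecMul, ← pow_succ']; exact hv _ u hu) (m d) hmd hk
            rw [Matrix.vecMul, dotProduct, Finset.sum_eq_single d] at h1
            · simpa [A, hdU, hd, hmd] using h1
            · intro i _ hi
              have : ¬ (i ∉ U ∧ i ∈ D ∧ m d ∈ D ∧ m d = m i) :=
                fun h => hi (hinj i h.1 d hdU h.2.2.2.symm)
              simp only [A, Matrix.of_apply, if_neg this, mul_zero]
            · simp
  intro s
  induction s using Nat.strong_induction_on with
  | _ s ih =>
    intro D hs hUD hDm ⟨A, hA, hN⟩
    by_cases hDu : D = Finset.univ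
    · refine ⟨A, fun i j h => (hA i j h).1, fun v hv => ?_⟩
      ext d
      exact hN v hv d (by simp [hDu])
    · obtain ⟨z0, hz0⟩ : ∃ z, z ∉ D := by
        by_contra! h
        exact hDu (Finset.eq_univ_iff_forall.2 h)
      obtain ⟨x, y, hy, hx, hyx⟩ : ∃ x y, y ∈ D ∧ x ∉ D ∧ R y x := by
        obtain ⟨u, hu, hp⟩ := hreach z0
        by_contra! h
        have : ∀ z, Relation.ReflTransGen R u z → z ∈ D := by
          intro z hz
          induction hz with
          | refl => exact hUD u hu
          | tail _ h1 h2 =>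
            by_contra h3
            exact h _ _ h2 h3 h1
        exact hz0 (this _ hp)
      have hDU : ∀ z, z ∉ D → z ∉ U := fun z hz hu => hz (hUD z hu)
      let f : {z // z ∉ D} → {z // z ∉ D} := fun z => ⟨m z.1, hDm z.1 z.2⟩
      have hf : Function.Injective f := by
        intro z w h
        have : m z.1 = m w.1 := congrArg Subtype.val h
        exact Subtype.ext (hinj _ (hDU _ z.2) _ (hDU _ w.2) this)
      obtain ⟨l, hl, hperx⟩ : ∃ l, 0 < l ∧ f^[l] ⟨x, hx⟩ = ⟨x, hx⟩ := by
        obtain ⟨l, hl, h⟩ := hf.mem_periodicPts ⟨x, hx⟩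
        exact ⟨l, hl, h⟩
      have hfm : ∀ k z, (f^[k] z).1 = m^[k] z.1 := by
        intro k
        induction k with
        | zero => simp
        | succ k ih => intro z; rw [Function.iterate_succ_apply, ih, Function.iterate_succ_apply]
      have hperm : m^[l] x = x := by
        rw [← hfm l ⟨x, hx⟩, hperx]
      let C : Finset Z := Finset.univ.filter fun z => ∃ k, m^[k] x = z
      have hC : ∀ z, z ∈ C ↔ ∃ k, m^[k] x = z := by simp [C]
      have hCD : ∀ c ∈ C, c ∉ D := by
        intro c hc
        obtain ⟨k, rfl⟩ := (hC c).1 hc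
        rw [← hfm k ⟨x, hx⟩]
        exact (f^[k] ⟨x, hx⟩).2
      have hxC : x ∈ C := (hC x).2 ⟨0, rfl⟩
      have hmC : ∀ c ∈ C, m c ∈ C := by
        intro c hc
        obtain ⟨k, rfl⟩ := (hC c).1 hc
        exact (hC _).2 ⟨k + 1, Function.iterate_succ_apply' m k x⟩
      have hinjC : ∀ c ∈ C, ∀ c' ∈ C, m c = m c' → c = c' := fun c hc c' hc' h =>
        hinj _ (hDU _ (hCD c hc)) _ (hDU _ (hCD c' hc')) h
      have hper : ∀ c ∈ C, m^[l] c = c := by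
        intro c hc
        obtain ⟨k, rfl⟩ := (hC c).1 hc
        rw [← Function.iterate_add_apply, add_comm, Function.iterate_add_apply, hperm]
      have htr : ∀ c ∈ C, ∃ j, m^[j] c = x := by
        intro c hc
        obtain ⟨k, rfl⟩ := (hC c).1 hc
        refine ⟨l * k - k, ?_⟩
        rw [← Function.iterate_add_apply, Nat.sub_add_cancel (Nat.le_mul_of_pos_left k hl)]
        exact Function.IsPeriodicPt.mul_const (show Function.IsPeriodicPt m l x from hperm) k
      obtain ⟨A2, hA2, hN2⟩ := Lin.cycle_ext U m D C hUD hCD x y hxC hy hmC hinjC l hl hper htr A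
        (fun i j h => (hA i j h).2) hN
      refine ih (D ∪ C)ᶜ.card ?_ (D ∪ C) rfl ?_ ?_ ⟨A2, ?_, ?_⟩
      · rw [← hs]
        apply Finset.card_lt_card
        rw [Finset.compl_ssubset_compl]
        refine ⟨Finset.subset_union_left, fun h => hx (h (Finset.mem_union_right _ hxC))⟩
      · exact fun u hu => Finset.mem_union_left _ (hUD u hu)
      · intro z hz hmz
        rw [Finset.mem_union, not_or] at hz
        rcases Finset.mem_union.1 hmz with h | h
        · exact hDm z hz.1 h
        · have h1 : m^[l - 1] (m z) ∈ C := by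
            obtain ⟨k, hk⟩ := (hC _).1 h
            rw [← hk, ← Function.iterate_add_apply]
            exact (hC _).2 ⟨_, rfl⟩
          have h2 : m (m^[l - 1] (m z)) = m z := by
            rw [← Function.iterate_succ_apply' m, Nat.succ_eq_add_one, Nat.sub_add_cancel hl,
              hper _ h]
          have := hinj _ (hDU _ (hCD _ h1)) _ (hDU _ hz.1) h2
          exact hz.2 (this ▸ h1)
      · intro i j hij
        rcases hA2 i j hij with h | ⟨rfl, rfl⟩ | ⟨h, rfl⟩
        · obtain ⟨h1, h2, h3⟩ := hA i j h
          exact ⟨h1, Finset.mem_union_left _ h2, Finset.mem_union_left _ h3⟩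
        · exact ⟨hyx, Finset.mem_union_right _ hxC, Finset.mem_union_left _ hy⟩
        · exact ⟨hm i (hDU _ (hCD i h)), Finset.mem_union_right _ h,
            Finset.mem_union_right _ (hmC i h)⟩
      · intro v hv d hd
        exact hN2 v hv d (Finset.mem_union.1 hd)

theorem Lin.rank_iff {X Y : Type*} [Fintype X] [DecidableEq X] [Fintype Y]
    (C : Matrix X Y ℝ) : C.rank = Fintype.card X ↔ ∀ v : X → ℝ, v ᵥ* C = 0 → v = 0 := by
  rw [Matrix.rank_eq_finrank_span_row, eq_comm]
  have h1 := linearIndependent_iff_card_eq_finrank_span (R := ℝ) (b := C.row)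
  rw [Set.finrank] at h1
  rw [← h1, ← Matrix.vecMul_injective_iff]
  exact injective_iff_map_eq_zero C.vecMulLinear

theorem Lin.det_iff {X Y : Type*} [Fintype X] [DecidableEq X] [Fintype Y]
    (C : Matrix X Y ℝ) : C.rank = Fintype.card X ↔ (C * Cᵀ).det ≠ 0 := by
  rw [← Matrix.rank_self_mul_transpose, Lin.rank_iff, ne_eq, ← Matrix.exists_vecMul_eq_zero_iff]
  push Not
  exact forall_congr' fun v => by tauto

theorem Lin.ctrl_iff {X U : Type*} [Fintype X] [DecidableEq X] [Fintype U]
    (A : Matrix X X ℝ) (B : Matrix X U ℝ) :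
    Controllable A B ↔ ∀ v : X → ℝ, (∀ k : ℕ, ∀ u, (v ᵥ* (A ^ k * B)) u = 0) → v = 0 := by
  rw [Controllable, Lin.rank_iff]
  refine forall_congr' fun v => imp_congr_left ⟨fun h k u => ?_, fun h => ?_⟩
  · have h0 : ∀ i < Fintype.card X, (v ᵥ* (A ^ i * B)) u = 0 := fun i hi =>
      congrFun h (⟨i, hi⟩, u)
    rcases isEmpty_or_nonempty X with hX | hX
    · simp [Matrix.vecMul, dotProduct]
    have hd : (Polynomial.X ^ k %ₘ A.charpoly).natDegree < Fintype.card X := by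
      rw [← A.charpoly_natDegree_eq_dim]
      refine Polynomial.natDegree_modByMonic_lt _ A.charpoly_monic fun h => ?_
      have := A.charpoly_natDegree_eq_dim
      rw [h, Polynomial.natDegree_one] at this
      exact Fintype.card_ne_zero this.symm
    rw [Matrix.pow_eq_aeval_mod_charpoly, Polynomial.aeval_eq_sum_range' hd, Matrix.sum_mul]
    have : ∀ s : Finset ℕ, ∀ f : ℕ → Matrix X U ℝ, v ᵥ* (∑ i ∈ s, f i) = ∑ i ∈ s, v ᵥ* f i := by
      intro s f
      classical
      induction s using Finset.induction_on with
      | empty => simp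
      | insert a s ha ih => rw [Finset.sum_insert ha, Finset.sum_insert ha, vecMul_add, ih]
    rw [this, Finset.sum_apply]
    refine Finset.sum_eq_zero fun i hi => ?_
    rw [Matrix.smul_mul, Matrix.vecMul_smul, Pi.smul_apply, h0 i (Finset.mem_range.1 hi), smul_zero]
  · ext ⟨i, u⟩
    exact h i u

theorem Lin.perturb {X U : Type*} [Fintype X] [DecidableEq X] [Fintype U]
    (Ab : Matrix X X Bool) (Bb : Matrix X U Bool) (A : Matrix X X ℝ) (B : Matrix X U ℝ)
    (hA : ∀ i j, A i j ≠ 0 → Ab i j = true) (hB : ∀ i j, B i j ≠ 0 → Bb i j = true)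
    (hc : Controllable A B) : StructurallyControllable Ab Bb := by
  let At : ℝ → Matrix X X ℝ := fun t => Matrix.of fun i j => A i j + t * (if Ab i j then 1 else 0)
  let Bt : ℝ → Matrix X U ℝ := fun t => Matrix.of fun i j => B i j + t * (if Bb i j then 1 else 0)
  have hAt : Continuous At := by
    refine continuous_matrix fun i j => ?_
    simp only [At, Matrix.of_apply]
    fun_prop
  have hBt : Continuous Bt := by
    refine continuous_matrix fun i j => ?_
    simp only [Bt, Matrix.of_apply]
    fun_prop
  have hCt : Continuous fun t => ctrbMatrix (At t) (Bt t) := by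
    refine continuous_matrix fun i kj => ?_
    exact ((hAt.pow _).matrix_mul hBt).matrix_elem i kj.2
  have hdet : Continuous fun t => (ctrbMatrix (At t) (Bt t) * (ctrbMatrix (At t) (Bt t))ᵀ).det :=
    (hCt.matrix_mul hCt.matrix_transpose).matrix_det
  have hA0 : At 0 = A := by ext i j; simp [At]
  have hB0 : Bt 0 = B := by ext i j; simp [Bt]
  have h0 : (ctrbMatrix (At 0) (Bt 0) * (ctrbMatrix (At 0) (Bt 0))ᵀ).det ≠ 0 := by
    rw [hA0, hB0]; exact (Lin.det_iff _).1 hc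
  have ev1 : ∀ᶠ t in nhdsWithin (0 : ℝ) {0}ᶜ,
      (ctrbMatrix (At t) (Bt t) * (ctrbMatrix (At t) (Bt t))ᵀ).det ≠ 0 :=
    (hdet.continuousAt.eventually_ne h0).filter_mono nhdsWithin_le_nhds
  have gen : ∀ a : ℝ, ∀ᶠ t in nhdsWithin (0 : ℝ) {0}ᶜ, a + t ≠ 0 := by
    intro a
    by_cases ha : a = 0
    · filter_upwards [self_mem_nhdsWithin] with t ht
      simpa [ha] using ht
    · have : Continuous fun t : ℝ => a + t := by fun_prop
      exact (this.continuousAt.eventually_ne (by simpa using ha)).filter_mono nhdsWithin_le_nhds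
  have ev2 : ∀ᶠ t in nhdsWithin (0 : ℝ) {0}ᶜ, ∀ i j, A i j + t ≠ 0 :=
    Filter.eventually_all.2 fun i => Filter.eventually_all.2 fun j => gen _
  have ev3 : ∀ᶠ t in nhdsWithin (0 : ℝ) {0}ᶜ, ∀ i j, B i j + t ≠ 0 :=
    Filter.eventually_all.2 fun i => Filter.eventually_all.2 fun j => gen _
  obtain ⟨t, h1, h2, h3⟩ := (ev1.and (ev2.and ev3)).exists
  refine ⟨At t, Bt t, fun i j => ?_, fun i j => ?_, (Lin.det_iff _).2 h1⟩
  · by_cases h : Ab i j = true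
    · simpa [At, h] using h2 i j
    · have : A i j = 0 := by
        by_contra h'
        exact h (hA i j h')
      simp [At, h, this]
  · by_cases h : Bb i j = true
    · simpa [Bt, h] using h3 i j
    · have : B i j = 0 := by
        by_contra h'
        exact h (hB i j h')
      simp [Bt, h, this]

theorem Lin.reach_of_sc {X U : Type*} [Fintype X] [DecidableEq X] [Fintype U]
    (Ab : Matrix X X Bool) (Bb : Matrix X U Bool) (h : StructurallyControllable Ab Bb) (x : X) :
    InputReachable Ab Bb x := by
  obtain ⟨A, B, hA, hB, hc⟩ := h
  rw [Lin.ctrl_iff] at hc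
  by_contra hx
  have key : ∀ k : ℕ, ∀ x, ¬ InputReachable Ab Bb x → ∀ u, (A ^ k * B) x u = 0 := by
    intro k
    induction k with
    | zero =>
      intro x hx u
      rw [pow_zero, Matrix.one_mul, hB]
      by_contra hb
      exact hx ⟨u, Relation.ReflTransGen.single (by simpa [sysDigraphRel] using hb)⟩
    | succ k ih =>
      intro x hx u
      rw [pow_succ', Matrix.mul_assoc, Matrix.mul_apply]
      refine Finset.sum_eq_zero fun j _ => ?_
      by_cases hj : InputReachable Ab Bb j
      · have : A x j = 0 := by
          rw [hA]
          by_contra hb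
          obtain ⟨w, hw⟩ := hj
          exact hx ⟨w, hw.tail (by simpa [sysDigraphRel] using hb)⟩
        rw [this, zero_mul]
      · rw [ih j hj u, mul_zero]
  have := hc (Pi.single x 1) (fun k u => by simpa using key k x hx u)
  simpa using congrFun this x

theorem Lin.suff {X U : Type*} [Fintype X] [DecidableEq X] [Fintype U] [DecidableEq U]
    (Ab : Matrix X X Bool) (Bb : Matrix X U Bool) (g : X → X ⊕ U) (hg : Function.Injective g)
    (hge : ∀ x, sysBipEdge Ab Bb (g x) x) (hr : ∀ x, InputReachable Ab Bb x) :
    StructurallyControllable Ab Bb := by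
  let m : X ⊕ U → X ⊕ U := Sum.elim g Sum.inr
  obtain ⟨A, hA, hN⟩ := Lin.graph (Set.range (Sum.inr : U → X ⊕ U)) m (sysDigraphRel Ab Bb)
    (by
      rintro (x | u) hz
      · have := hge x
        simp only [m, Sum.elim_inl]
        cases h : g x <;> rw [h] at this <;> exact this
      · exact absurd ⟨u, rfl⟩ hz)
    (by
      rintro (x | u) hz (y | w) hw h
      · exact congrArg _ (hg h)
      · exact absurd ⟨w, rfl⟩ hw
      · exact absurd ⟨u, rfl⟩ hz
      · exact absurd ⟨u, rfl⟩ hz)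
    (by
      rintro (x | u)
      · obtain ⟨u, hu⟩ := hr x
        exact ⟨_, ⟨u, rfl⟩, hu⟩
      · exact ⟨_, ⟨u, rfl⟩, Relation.ReflTransGen.refl⟩)
  refine Lin.perturb Ab Bb (A.submatrix Sum.inl Sum.inl) (A.submatrix Sum.inl Sum.inr)
    (fun i j h => hA _ _ h) (fun i j h => hA _ _ h) ((Lin.ctrl_iff _ _).2 fun v hv => ?_)
  set A1 := A.submatrix Sum.inl Sum.inl with hA1
  set B1 := A.submatrix Sum.inl Sum.inr with hB1
  have hzero : ∀ u z, A (Sum.inr u) z = 0 := by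
    intro u z
    by_contra h
    have := hA _ _ h
    cases z <;> exact this
  have hl : ∀ (w : X ⊕ U → ℝ) (x : X), (w ᵥ* A) (Sum.inl x) = ((fun x => w (Sum.inl x)) ᵥ* A1) x := by
    intro w x
    simp [Matrix.vecMul, dotProduct, hzero, hA1]
  have hrr : ∀ (w : X ⊕ U → ℝ) (u : U), (w ᵥ* A) (Sum.inr u) = ((fun x => w (Sum.inl x)) ᵥ* B1) u := by
    intro w u
    simp [Matrix.vecMul, dotProduct, hzero, hB1]
  let v' : X ⊕ U → ℝ := Sum.elim v 0
  have hk : ∀ k : ℕ, (fun x => (v' ᵥ* A ^ k) (Sum.inl x)) = v ᵥ* A1 ^ k := by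
    intro k
    induction k with
    | zero => ext x; simp [v']
    | succ k ih =>
      ext x
      rw [pow_succ, ← Matrix.vecMul_vecMul, hl, ih, Matrix.vecMul_vecMul, ← pow_succ]
  have := hN v' (by
    rintro k _ ⟨u, rfl⟩
    cases k with
    | zero => simp [v']
    | succ k =>
      rw [pow_succ, ← Matrix.vecMul_vecMul, hrr, hk, Matrix.vecMul_vecMul]
      exact hv k u)
  ext x
  exact congrFun this (Sum.inl x)

theorem Lin.matching_fun {X U : Type*} {Ab : Matrix X X Bool} {Bb : Matrix X U Bool}
    (h : ∃ M : Set ((X ⊕ U) × X), IsMatching (sysBipEdge Ab Bb) M ∧ rightUnmatched M = ∅) :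
    ∃ g : X → X ⊕ U, Function.Injective g ∧ ∀ x, sysBipEdge Ab Bb (g x) x := by
  obtain ⟨M, ⟨h1, h2, h3⟩, hM⟩ := h
  have : ∀ x, ∃ a, (a, x) ∈ M := by
    intro x
    by_contra! hx
    have : x ∈ rightUnmatched M := by
      rintro ⟨a, b⟩ he rfl
      exact hx a he
    rw [hM] at this
    exact this
  choose g hg using this
  refine ⟨g, fun x y hxy => ?_, fun x => h1 _ (hg x)⟩
  exact congrArg Prod.snd (h2 _ (hg x) _ (hg y) hxy)

/-- Theorem 1 of the paper: for a system of `r` similar subsystems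
parametrized by `(Ā', B̄', H̄, Ē)` where `(Ā', B̄')` is not structurally controllable but its
system bipartite graph has a matching with no right-unmatched vertices, the overall system
is structurally controllable iff `(Ā' ∨ H̄, B̄')` is structurally controllable and the
condensed graph `D(Ē)` has no source. -/
theorem similar_system_struct_controllable_iff
    {n p : ℕ} {r : ℕ} (hr : 0 < r)
    (A' H : Matrix (Fin n) (Fin n) Bool) (B' : Matrix (Fin n) (Fin p) Bool)
    (E : Matrix (Fin r) (Fin r) Bool) (hE : ∀ i, E i i = false)
    (hnsc : ¬ StructurallyControllable A' B')
    (hmatch : ∃ M : Set ((Fin n ⊕ Fin p) × Fin n),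
      IsMatching (sysBipEdge A' B') M ∧ rightUnmatched M = ∅) :
    StructurallyControllable (simA r A' H E) (simB r B') ↔
      (StructurallyControllable (orMat A' H) B' ∧ ∀ i : Fin r, ∃ j : Fin r, E i j = true) := by
  classical
  obtain ⟨g, hginj, hg⟩ := Lin.matching_fun hmatch
  have hnr : ¬ ∀ x, InputReachable A' B' x := fun h => hnsc (Lin.suff A' B' g hginj hg h)
  constructor
  · intro hsc
    have hreach := Lin.reach_of_sc _ _ hsc
    refine ⟨Lin.suff _ _ g hginj ?_ ?_, ?_⟩
    · intro x
      have := hg x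
      cases h : g x <;> rw [h] at this <;> simp_all [sysBipEdge, orMat]
    · intro x
      obtain ⟨⟨i, u⟩, hu⟩ := hreach (⟨0, hr⟩, x)
      refine ⟨u, ?_⟩
      refine Relation.ReflTransGen.lift (Sum.map Prod.snd Prod.snd) ?_ _ _ hu
      rintro (⟨i, a⟩ | ⟨i, a⟩) (⟨j, b⟩ | ⟨j, b⟩) hab
      · simp only [sysDigraphRel, simA, Sum.map_inl, orMat, Function.onFun] at hab ⊢
        split_ifs at hab <;> simp_all
      · exact hab
      · simp only [sysDigraphRel, simB, Sum.map_inl, Sum.map_inr, Function.onFun] at hab ⊢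
        split_ifs at hab <;> simp_all
      · exact hab
    · intro i
      by_contra! hi
      apply hnr
      have key : ∀ (s : Fin r × Fin p) (z : (Fin r × Fin n) ⊕ (Fin r × Fin p)),
          Relation.ReflTransGen (sysDigraphRel (simA r A' H E) (simB r B')) (Sum.inr s) z →
          ∀ x, z = Sum.inl (i, x) → InputReachable A' B' x := by
        intro s z hz
        induction hz with
        | refl => intro x hx; cases hx
        | @tail b c hb hbc ih =>
          rintro x rfl
          rcases b with ⟨j, a⟩ | ⟨j, a⟩
          · have hE' : E i j = false := by simpa using hi j
            simp only [sysDigraphRel, simA, hE', Bool.false_and, Bool.or_false] at hbc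
            split_ifs at hbc with hij
            subst hij
            obtain ⟨u, hu⟩ := ih a rfl
            exact ⟨u, hu.tail hbc⟩
          · simp only [sysDigraphRel, simB] at hbc
            split_ifs at hbc with hij
            exact ⟨a, Relation.ReflTransGen.single hbc⟩
      intro x
      obtain ⟨s, hs⟩ := hreach (i, x)
      exact key s _ hs x rfl
  · rintro ⟨hsc, hsrc⟩
    have hreach := Lin.reach_of_sc _ _ hsc
    refine Lin.suff _ _ (fun q => Sum.map (Prod.mk q.1) (Prod.mk q.1) (g q.2)) ?_ ?_ ?_
    · rintro ⟨i, x⟩ ⟨j, y⟩ hxy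
      simp only at hxy
      have : i = j ∧ g x = g y := by
        cases h1 : g x <;> cases h2 : g y <;> simp_all
      rw [this.1, hginj this.2]
    · rintro ⟨i, x⟩
      have := hg x
      cases h : g x <;> rw [h] at this <;> simp_all [sysBipEdge, simA, simB]
    · have key : ∀ (u : Fin p) (z : Fin n ⊕ Fin p),
          Relation.ReflTransGen (sysDigraphRel (orMat A' H) B') (Sum.inr u) z →
          ∀ x, z = Sum.inl x → ∀ i, InputReachable (simA r A' H E) (simB r B') (i, x) := by
        intro u z hz
        induction hz with
        | refl => intro x hx; cases hx
        | @tail b c hb hbc ih =>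
          rintro x rfl i
          rcases b with a | a
          · simp only [sysDigraphRel, orMat, Bool.or_eq_true] at hbc
            rcases hbc with hbc | hbc
            · obtain ⟨s, hs⟩ := ih a rfl i
              exact ⟨s, hs.tail (by simp [sysDigraphRel, simA, hbc])⟩
            · obtain ⟨j, hj⟩ := hsrc i
              obtain ⟨s, hs⟩ := ih a rfl j
              exact ⟨s, hs.tail (by simp [sysDigraphRel, simA, hbc, hj])⟩
          · exact ⟨(i, a), Relation.ReflTransGen.single (by simpa [sysDigraphRel, simB] using hbc)⟩
      rintro ⟨i, x⟩
      obtain ⟨u, hu⟩ := hreach x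
      exact key u _ hu x rfl i
end

section
/- Let D = (V, E) be a digraph and let M* be a maximum matching of the associated bipartite graph B(V, V, E). Then the spanning subgraph (V, M*), where each matched pair (v, w) ∈ M* is taken as a directed edge from v to w, is a disjoint union of cycles and elementary paths (an isolated vertex counting as an elementary path with no edges) that spans V, where the elementary paths begin at the right-unmatched vertices and end at the left-unmatched vertices of M*. Moreover this decomposition is minimal: no spanning decomposition of D into vertex-disjoint elementary paths and cycles contains strictly fewer elementary paths; equivalently, the minimum number of elementary paths over all such decompositions equals |V| − |M*|. -/
open Matrix

/-- A decomposition of the vertex set of a digraph with edge relation `R` into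
vertex-disjoint elementary paths `P` and cycles `C` spanning all vertices: each list in `P`
is a nonempty elementary path (consecutive vertices joined by edges of `R`; an isolated
vertex is a path with no edges), each list in `C` is an elementary cycle (also with an edge
from its last vertex back to its first), and every vertex occurs exactly once overall. -/
def IsPathCycleDecomp {V : Type*} (R : V → V → Prop) (P C : List (List V)) : Prop :=
  (∀ l ∈ P, l ≠ [] ∧ l.Nodup ∧ l.Chain' R) ∧
  (∀ l ∈ C, ∃ h : l ≠ [], l.Nodup ∧ List.Chain' R (l ++ [l.head h])) ∧
  ((P ++ C).flatten).Nodup ∧ (∀ v : V, v ∈ (P ++ C).flatten)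

lemma pcd_succ {V : Type*} {R : V → V → Prop} {m : List V} {x a : V}
    (h : List.IsChain R (m ++ [x])) (ha : a ∈ m) : ∃ c, R a c := by
  induction m with
  | nil => simp at ha
  | cons y m ih =>
    rcases m with _ | ⟨z, m⟩
    · simp at ha h
      exact ⟨x, ha ▸ h⟩
    · simp only [List.cons_append, List.isChain_cons_cons] at h
      rcases List.mem_cons.1 ha with rfl | ha
      · exact ⟨z, h.1⟩
      · exact ih (by simpa using h.2) ha

lemma pcd_pred {V : Type*} {R : V → V → Prop} {m : List V} {x b : V}
    (h : List.IsChain R (x :: m)) (hb : b ∈ m) : ∃ c, R c b := by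
  induction m generalizing x with
  | nil => simp at hb
  | cons y m ih =>
    rw [List.isChain_cons_cons] at h
    rcases List.mem_cons.1 hb with rfl | hb
    · exact ⟨x, h.1⟩
    · exact ih h.2 hb

lemma pcd_perm {V : Type*} {R : V → V → Prop} {P Q C : List (List V)} (hp : P.Perm Q)
    (h : IsPathCycleDecomp R P C) : IsPathCycleDecomp R Q C := by
  obtain ⟨h1, h2, h3, h4⟩ := h
  have hf : ((P ++ C).flatten).Perm ((Q ++ C).flatten) :=
    (hp.append_right C).flatten
  exact ⟨fun l hl => h1 l (hp.mem_iff.2 hl), h2, hf.nodup_iff.1 h3, fun v => hf.mem_iff.1 (h4 v)⟩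

lemma pcd_step {V : Type*} (M : Set (V × V)) (a b : V)
    (ha : ∀ c, (a, c) ∉ M) (hb : ∀ c, (c, b) ∉ M) (P C : List (List V))
    (hD : IsPathCycleDecomp (fun v w => (v, w) ∈ M) P C)
    (hE : ∀ l ∈ P, ∃ h : l ≠ [],
        l.head h ∈ rightUnmatched M ∧ l.getLast h ∈ leftUnmatched M) :
    ∃ P' C' : List (List V),
      IsPathCycleDecomp (fun v w => (v, w) ∈ insert (a, b) M) P' C' ∧
      (∀ l ∈ P', ∃ h : l ≠ [],
        l.head h ∈ rightUnmatched (insert (a, b) M) ∧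
        l.getLast h ∈ leftUnmatched (insert (a, b) M)) ∧
      P'.length + 1 = P.length := by
  have hmono : ∀ l : List V, l.IsChain (fun v w => (v, w) ∈ M) →
      l.IsChain (fun v w => (v, w) ∈ insert (a, b) M) :=
    fun l hl => hl.imp (fun _ _ h => Set.mem_insert_of_mem _ h)
  have hA : ∃ s, s ++ [a] ∈ P := by
    have := hD.2.2.2 a
    rw [List.mem_flatten] at this
    obtain ⟨l, hl, hal⟩ := this
    rcases List.mem_append.1 hl with hl | hl
    · obtain ⟨hne, -, hc⟩ := hD.1 l hl
      obtain ⟨s, x, rfl⟩ := (List.eq_nil_or_concat' l).resolve_left hne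
      rcases List.mem_append.1 hal with h | h
      · obtain ⟨c, hc⟩ := pcd_succ hc h
        exact absurd hc (ha c)
      · simp at h
        subst h
        exact ⟨s, hl⟩
    · obtain ⟨hne, -, hc⟩ := hD.2.1 l hl
      obtain ⟨c, hc⟩ := pcd_succ hc hal
      exact absurd hc (ha c)
  have hB : ∃ t, b :: t ∈ P := by
    have := hD.2.2.2 b
    rw [List.mem_flatten] at this
    obtain ⟨l, hl, hbl⟩ := this
    rcases List.mem_append.1 hl with hl | hl
    · obtain ⟨hne, -, hc⟩ := hD.1 l hl
      obtain ⟨x, s, rfl⟩ := List.exists_cons_of_ne_nil hne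
      rcases List.mem_cons.1 hbl with h | h
      · subst h
        exact ⟨s, hl⟩
      · obtain ⟨c, hc⟩ := pcd_pred hc h
        exact absurd hc (hb c)
    · obtain ⟨hne, -, hc⟩ := hD.2.1 l hl
      obtain ⟨x, s, rfl⟩ := List.exists_cons_of_ne_nil hne
      obtain ⟨c, hc⟩ := pcd_pred (m := s ++ [x]) (b := b) hc (by simpa [or_comm] using hbl)
      exact absurd hc (hb c)
  have hR : ∀ x, x ∈ rightUnmatched M → x ≠ b → x ∈ rightUnmatched (insert (a, b) M) := by
    rintro x hx hxb e (rfl | he)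
    · exact fun h => hxb h.symm
    · exact hx e he
  have hL : ∀ x, x ∈ leftUnmatched M → x ≠ a → x ∈ leftUnmatched (insert (a, b) M) := by
    rintro x hx hxb e (rfl | he)
    · exact fun h => hxb h.symm
    · exact hx e he
  obtain ⟨s, hs⟩ := hA
  obtain ⟨t, ht⟩ := hB
  obtain ⟨P1, hP1⟩ : ∃ P1, P.Perm ((s ++ [a]) :: P1) := by
    classical exact ⟨_, List.perm_cons_erase hs⟩
  have hD1 := pcd_perm hP1 hD
  have hlen := hP1.length_eq
  by_cases heq : s ++ [a] = b :: t
  · refine ⟨P1, (s ++ [a]) :: C, ⟨?_, ?_, ?_, ?_⟩, ?_, ?_⟩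
    · intro l hl
      obtain ⟨h1, h2, h3⟩ := hD1.1 l (List.mem_cons_of_mem _ hl)
      exact ⟨h1, h2, hmono _ h3⟩
    · intro l hl
      rcases List.mem_cons.1 hl with rfl | hl
      · refine ⟨by simp, (hD.1 _ hs).2.1, ?_⟩
        have h1 : (s ++ [a]).head (by simp) = b := by simp [heq]
        rw [h1]
        have hc := hmono _ (hD.1 _ hs).2.2
        change List.IsChain _ _
        rw [List.isChain_append]
        refine ⟨hc, by simp, ?_⟩
        simp
      · obtain ⟨h1, h2, h3⟩ := hD.2.1 l hl
        exact ⟨h1, h2, hmono _ h3⟩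
    · refine (List.Perm.nodup_iff ?_).1 hD1.2.2.1
      exact (List.perm_middle (l₁ := P1) (a := s ++ [a]) (l₂ := C)).symm.flatten
    · intro v
      have := hD1.2.2.2 v
      simp only [List.mem_flatten, List.mem_append, List.mem_cons] at this ⊢
      grind
    · intro l hl
      obtain ⟨h, h1, h2⟩ := hE l (hP1.mem_iff.2 (List.mem_cons_of_mem _ hl))
      have hnd := hD1.2.2.1
      simp only [List.cons_append, List.flatten_cons] at hnd
      have hdis := List.disjoint_of_nodup_append hnd
      have hmem : ∀ x ∈ l, x ∈ (P1 ++ C).flatten := fun x hx =>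
        List.mem_flatten.2 ⟨l, by simp [hl], hx⟩
      refine ⟨h, hR _ h1 ?_, hL _ h2 ?_⟩
      · intro h3
        exact hdis (a := b) (by simp [heq]) (hmem b (h3 ▸ List.head_mem h))
      · intro h3
        exact hdis (a := a) (by simp) (hmem a (h3 ▸ List.getLast_mem h))
    · simp [hlen]
  · have ht1 : b :: t ∈ P1 := by
      rcases List.mem_cons.1 (hP1.mem_iff.1 ht) with h | h
      · exact absurd h.symm heq
      · exact h
    obtain ⟨P2, hP2⟩ : ∃ P2, P1.Perm ((b :: t) :: P2) := by
      classical exact ⟨_, List.perm_cons_erase ht1⟩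
    have hlen2 := hP2.length_eq
    have hPP : P.Perm ((s ++ [a]) :: (b :: t) :: P2) := hP1.trans (hP2.cons _)
    have hD2 := pcd_perm hPP hD
    have hfl : ((((s ++ [a]) :: (b :: t) :: P2) ++ C).flatten) =
        ((((s ++ [a]) ++ (b :: t)) :: P2) ++ C).flatten := by simp
    have hnd := hD2.2.2.1
    rw [hfl] at hnd
    have hnd' := hnd
    simp only [List.cons_append, List.flatten_cons] at hnd
    have hdis := List.disjoint_of_nodup_append hnd
    have hnd1 := List.Nodup.of_append_left hnd
    refine ⟨((s ++ [a]) ++ (b :: t)) :: P2, C, ⟨?_, ?_, hnd', ?_⟩, ?_, ?_⟩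
    · intro l hl
      rcases List.mem_cons.1 hl with rfl | hl
      · refine ⟨by simp, hnd1, ?_⟩
        change List.IsChain _ _
        rw [List.isChain_append]
        refine ⟨hmono _ (hD.1 _ hs).2.2, hmono _ (hD.1 _ ht).2.2, ?_⟩
        simp
      · obtain ⟨h1, h2, h3⟩ := hD2.1 l (by simp [hl])
        exact ⟨h1, h2, hmono _ h3⟩
    · intro l hl
      obtain ⟨h1, h2, h3⟩ := hD.2.1 l hl
      exact ⟨h1, h2, hmono _ h3⟩
    · intro v
      rw [← hfl]
      exact hD2.2.2.2 v
    · intro l hl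
      rcases List.mem_cons.1 hl with rfl | hl
      · refine ⟨by simp, ?_, ?_⟩
        · obtain ⟨h, h1, h2⟩ := hE _ hs
          rw [List.head_append_left h]
          refine hR _ h1 ?_
          intro h3
          exact List.disjoint_of_nodup_append hnd1 (a := b) (h3 ▸ List.head_mem h) (by simp)
        · obtain ⟨h, h1, h2⟩ := hE _ ht
          rw [List.getLast_append_of_ne_nil _ h]
          refine hL _ h2 ?_
          intro h3
          exact List.disjoint_of_nodup_append hnd1 (a := a) (by simp) (h3 ▸ List.getLast_mem h)
      · obtain ⟨h, h1, h2⟩ := hE l (hPP.mem_iff.2 (by simp [hl]))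
        have hmem : ∀ x ∈ l, x ∈ (P2 ++ C).flatten := fun x hx =>
          List.mem_flatten.2 ⟨l, by simp [hl], hx⟩
        refine ⟨h, hR _ h1 ?_, hL _ h2 ?_⟩
        · intro h3
          exact hdis (a := b) (by simp) (hmem b (h3 ▸ List.head_mem h))
        · intro h3
          exact hdis (a := a) (by simp) (hmem a (h3 ▸ List.getLast_mem h))
    · simp [hlen, hlen2]

lemma pcd_exists {V : Type*} [Fintype V] (M : Finset (V × V))
    (h1 : ∀ e ∈ M, ∀ f ∈ M, e.1 = f.1 → e = f) (h2 : ∀ e ∈ M, ∀ f ∈ M, e.2 = f.2 → e = f) :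
    ∃ P C : List (List V),
      IsPathCycleDecomp (fun v w => (v, w) ∈ (M : Set (V × V))) P C ∧
      (∀ l ∈ P, ∃ h : l ≠ [],
        l.head h ∈ rightUnmatched (M : Set (V × V)) ∧
        l.getLast h ∈ leftUnmatched (M : Set (V × V))) ∧
      P.length + M.card = Fintype.card V := by
  classical
  induction M using Finset.induction_on with
  | empty =>
    have hfl : ∀ L : List V, (L.map (fun v => [v])).flatten = L := by
      intro L
      induction L with
      | nil => rfl
      | cons x L ih => simp [ih]
    refine ⟨(Finset.univ : Finset V).toList.map (fun v => [v]), [], ⟨?_, ?_, ?_, ?_⟩, ?_, ?_⟩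
    · intro l hl
      obtain ⟨v, -, rfl⟩ := List.mem_map.1 hl
      exact ⟨by simp, by simp, List.isChain_singleton _⟩
    · simp
    · rw [List.append_nil, hfl]
      exact Finset.nodup_toList _
    · intro v
      rw [List.append_nil, hfl]
      simp
    · intro l hl
      obtain ⟨v, -, rfl⟩ := List.mem_map.1 hl
      exact ⟨by simp, by simp [rightUnmatched], by simp [leftUnmatched]⟩
    · simp
  | insert e M he ih =>
    obtain ⟨a, b⟩ := e
    obtain ⟨P, C, hD, hE, hl⟩ := ih
      (fun e he f hf => h1 e (Finset.mem_insert_of_mem he) f (Finset.mem_insert_of_mem hf))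
      (fun e he f hf => h2 e (Finset.mem_insert_of_mem he) f (Finset.mem_insert_of_mem hf))
    obtain ⟨P', C', hD', hE', hl'⟩ := pcd_step (M : Set (V × V)) a b
      (fun c hc => he (by
        have := h1 (a, b) (Finset.mem_insert_self _ _) (a, c) (Finset.mem_insert_of_mem hc) rfl
        rw [this]; exact hc))
      (fun c hc => he (by
        have := h2 (a, b) (Finset.mem_insert_self _ _) (c, b) (Finset.mem_insert_of_mem hc) rfl
        rw [this]; exact hc)) P C hD hE
    rw [← Finset.coe_insert] at hD' hE'
    refine ⟨P', C', hD', hE', ?_⟩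
    rw [Finset.card_insert_of_notMem he]
    omega

lemma pcd_path_edges {V : Type*} {R : V → V → Prop} (l : List V) (x : V)
    (h : (x :: l).IsChain R) :
    ∃ L : List (V × V), (∀ e ∈ L, R e.1 e.2) ∧ (L.map Prod.fst ++ [(x :: l).getLast (by simp)] = x :: l) ∧
      L.map Prod.snd = l ∧ L.length = l.length := by
  induction l generalizing x with
  | nil => exact ⟨[], by simp, by simp, by simp, by simp⟩
  | cons y l ih =>
    rw [List.isChain_cons_cons] at h
    obtain ⟨L, h1, h2, h3, h4⟩ := ih y h.2
    refine ⟨(x, y) :: L, ?_, ?_, ?_, ?_⟩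
    · intro e he
      rcases List.mem_cons.1 he with rfl | he
      · exact h.1
      · exact h1 e he
    · simpa using h2
    · simpa using h3
    · simpa using h4

lemma pcd_paths_edges {V : Type*} {R : V → V → Prop} (P : List (List V))
    (h : ∀ l ∈ P, l ≠ [] ∧ l.IsChain R) :
    ∃ L : List (V × V), (∀ e ∈ L, R e.1 e.2) ∧ (L.map Prod.fst).Subperm P.flatten ∧
      (L.map Prod.snd).Subperm P.flatten ∧ L.length + P.length = P.flatten.length := by
  induction P with
  | nil => exact ⟨[], by simp, by simp, by simp, by simp⟩
  | cons l P ih =>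
    obtain ⟨L, h1, h2, h3, h4⟩ := ih (fun l hl => h l (List.mem_cons_of_mem _ hl))
    obtain ⟨hne, hc⟩ := h l (by simp)
    obtain ⟨x, l, rfl⟩ := List.exists_cons_of_ne_nil hne
    obtain ⟨K, k1, k2, k3, k4⟩ := pcd_path_edges l x hc
    refine ⟨K ++ L, ?_, ?_, ?_, ?_⟩
    · intro e he
      rcases List.mem_append.1 he with he | he
      · exact k1 e he
      · exact h1 e he
    · rw [List.map_append, List.flatten_cons]
      refine List.Subperm.append ?_ h2
      rw [← k2]
      exact (List.sublist_append_left _ _).subperm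
    · rw [List.map_append, List.flatten_cons]
      refine List.Subperm.append ?_ h3
      rw [k3]
      exact (List.sublist_cons_self _ _).subperm
    · simp only [List.length_append, List.length_cons, List.flatten_cons]
      omega

lemma pcd_cycles_edges {V : Type*} {R : V → V → Prop} (P : List (List V))
    (h : ∀ l ∈ P, ∃ h : l ≠ [], List.IsChain R (l ++ [l.head h])) :
    ∃ L : List (V × V), (∀ e ∈ L, R e.1 e.2) ∧ (L.map Prod.fst).Subperm P.flatten ∧
      (L.map Prod.snd).Subperm P.flatten ∧ L.length = P.flatten.length := by
  induction P with
  | nil => exact ⟨[], by simp, by simp, by simp, by simp⟩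
  | cons l P ih =>
    obtain ⟨L, h1, h2, h3, h4⟩ := ih (fun l hl => h l (List.mem_cons_of_mem _ hl))
    obtain ⟨hne, hc⟩ := h l (by simp)
    obtain ⟨x, l, rfl⟩ := List.exists_cons_of_ne_nil hne
    obtain ⟨K, k1, k2, k3, k4⟩ := pcd_path_edges (l ++ [x]) x hc
    have k2' : K.map Prod.fst = x :: l := by
      have : K.map Prod.fst ++ [x] = (x :: l) ++ [x] := by simpa using k2
      exact List.append_cancel_right this
    refine ⟨K ++ L, ?_, ?_, ?_, ?_⟩
    · intro e he
      rcases List.mem_append.1 he with he | he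
      · exact k1 e he
      · exact h1 e he
    · rw [List.map_append, List.flatten_cons]
      refine List.Subperm.append ?_ h2
      rw [k2']
    · rw [List.map_append, List.flatten_cons]
      refine List.Subperm.append ?_ h3
      rw [k3]
      exact (List.perm_append_singleton _ _).subperm
    · simp only [List.length_append, List.length_cons, List.flatten_cons, List.length_nil] at *
      omega

lemma pcd_matching {V : Type*} [Fintype V] {E : V → V → Prop} {P C : List (List V)}
    (h : IsPathCycleDecomp E P C) :
    ∃ M : Set (V × V), IsMatching E M ∧ M.ncard + P.length = Fintype.card V := by
  classical
  obtain ⟨L, l1, l2, l3, l4⟩ := pcd_paths_edges P (fun l hl => ⟨(h.1 l hl).1, (h.1 l hl).2.2⟩)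
  obtain ⟨K, k1, k2, k3, k4⟩ := pcd_cycles_edges C
    (fun l hl => ⟨(h.2.1 l hl).1, (h.2.1 l hl).2.2⟩)
  have hn := h.2.2.1
  have hcard : (P ++ C).flatten.length = Fintype.card V := by
    rw [← List.toFinset_card_of_nodup hn, ← Finset.card_univ]
    congr 1
    ext v
    simpa only [List.mem_toFinset, Finset.mem_univ, iff_true] using h.2.2.2 v
  have hsub : ∀ {A B : List V}, A.Subperm B → B.Nodup → A.Nodup := by
    rintro A B ⟨A', hp, hs⟩ hB
    exact hp.nodup_iff.1 (hB.sublist hs)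
  rw [List.flatten_append] at hn hcard
  have n1 : ((L ++ K).map Prod.fst).Nodup := by
    rw [List.map_append]
    exact hsub (l2.append k2) hn
  have n2 : ((L ++ K).map Prod.snd).Nodup := by
    rw [List.map_append]
    exact hsub (l3.append k3) hn
  refine ⟨((L ++ K).toFinset : Set (V × V)), ⟨?_, ?_, ?_⟩, ?_⟩
  · intro e he
    rcases List.mem_append.1 (List.mem_toFinset.1 he) with he | he
    · exact l1 e he
    · exact k1 e he
  · intro e he f hf hef
    exact List.inj_on_of_nodup_map n1 (List.mem_toFinset.1 he) (List.mem_toFinset.1 hf) hef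
  · intro e he f hf hef
    exact List.inj_on_of_nodup_map n2 (List.mem_toFinset.1 he) (List.mem_toFinset.1 hf) hef
  · rw [Set.ncard_coe_finset, List.toFinset_card_of_nodup (List.Nodup.of_map _ n1)]
    simp only [List.length_append] at hcard ⊢
    omega

/-- Lemma 2 of the paper, maximum matching decomposition: a maximum
matching `M` of the bipartite graph associated with a digraph `D = (V, E)` yields a spanning
decomposition of `V` into vertex-disjoint cycles and elementary paths whose edges are the
pairs of `M`, the paths beginning at right-unmatched and ending at left-unmatched vertices
of `M`; the number of paths is `|V| - |M|`, and no spanning path/cycle decomposition of `D`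
has strictly fewer paths. -/
theorem maxMatching_path_cycle_decomposition
    {V : Type*} [Fintype V] (E : V → V → Prop) (M : Set (V × V))
    (hM : IsMaxMatching E M) :
    ∃ P C : List (List V),
      IsPathCycleDecomp (fun v w => (v, w) ∈ M) P C ∧
      (∀ l ∈ P, ∃ h : l ≠ [],
        l.head h ∈ rightUnmatched M ∧ l.getLast h ∈ leftUnmatched M) ∧
      P.length = Fintype.card V - M.ncard ∧
      (∀ P' C' : List (List V), IsPathCycleDecomp E P' C' → P.length ≤ P'.length) := by
  classical
  obtain ⟨⟨hm1, hm2, hm3⟩, hmax⟩ := hM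
  obtain ⟨N, rfl⟩ : ∃ N : Finset (V × V), (N : Set (V × V)) = M :=
    ⟨M.toFinite.toFinset, by simp⟩
  obtain ⟨P, C, hD, hE, hl⟩ := pcd_exists N hm2 hm3
  refine ⟨P, C, hD, hE, ?_, ?_⟩
  · rw [Set.ncard_coe_finset]
    omega
  · intro P' C' h'
    obtain ⟨M', hM', hc⟩ := pcd_matching h'
    have := hmax M' hM'
    rw [Set.ncard_coe_finset] at this
    omega
end

section
/- A structural pair (Ā, B̄) with Ā ∈ {0,1}^{n×n}, B̄ ∈ {0,1}^{n×p} is structurally controllable if and only if (i) every state vertex of the system digraph D(Ā, B̄) is input-reachable, and (ii) the system bipartite graph B(Ā, B̄) has a matching with no right-unmatched vertices. -/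
open Matrix

/-- Popov-Belevitch-Hautus type condition, restricted to vectors supported on `S`. -/
def PBHOn {X U : Type*} [Fintype X] (A : Matrix X X ℝ) (B : Matrix X U ℝ) (S : Set X) : Prop :=
  ∀ (l : ℂ) (v : X → ℂ), (∀ i, i ∉ S → v i = 0) →
    (∀ j, ∑ i, v i * (A i j : ℂ) = l * v j) → (∀ k, ∑ i, v i * (B i k : ℂ) = 0) → v = 0

lemma exists_eigvec_of_invariant {E : Type*} [AddCommGroup E] [Module ℂ E] [FiniteDimensional ℂ E]
    (T : Module.End ℂ E) (V : Submodule ℂ E) (hV : ∀ v ∈ V, T v ∈ V) (w : E) (hw : w ∈ V)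
    (hw0 : w ≠ 0) : ∃ l : ℂ, ∃ v ∈ V, v ≠ 0 ∧ T v = l • v := by
  have : Nontrivial V := ⟨⟨⟨w, hw⟩, 0, fun h => hw0 (by simpa using congrArg Subtype.val h)⟩⟩
  obtain ⟨l, hl⟩ := Module.End.exists_eigenvalue (T.restrict hV)
  obtain ⟨v, hv⟩ := hl.exists_hasEigenvector
  refine ⟨l, v, v.2, fun h => hv.2 (Subtype.ext h), ?_⟩
  have := congrArg Subtype.val hv.apply_eq_smul
  simpa using this

/-- If every invariant subspace inside `K` is zero, then `T v = l v - e`, `v ∈ K` is solvable only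
for finitely many `l`. -/
lemma finite_bad {E : Type*} [AddCommGroup E] [Module ℂ E] [FiniteDimensional ℂ E]
    (T : Module.End ℂ E) (K : Submodule ℂ E)
    (hK : ∀ l : ℂ, ∀ v ∈ K, T v = l • v → v = 0) (e : E) (he : e ≠ 0) :
    {l : ℂ | ∃ v ∈ K, T v = l • v - e}.Finite := by
  set V : Submodule ℂ E := Submodule.span ℂ {v | v ∈ K ∧ ∃ l : ℂ, T v = l • v - e} with hVdef
  have hVK : V ≤ K := Submodule.span_le.2 (fun v hv => hv.1)
  by_cases heV : e ∈ V
  · exfalso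
    have hinv : ∀ v ∈ V, T v ∈ V := by
      intro v hv
      have : V ≤ V.comap T := by
        conv_lhs => rw [hVdef]
        refine Submodule.span_le.2 ?_
        rintro v ⟨hv, l, hl⟩
        simp only [Submodule.comap_coe, Set.mem_preimage, SetLike.mem_coe]
        rw [hl]
        exact V.sub_mem (V.smul_mem _ (Submodule.subset_span ⟨hv, l, hl⟩)) heV
      exact this hv
    obtain ⟨l, v, hv, hv0, h⟩ := exists_eigvec_of_invariant T V hinv e heV he
    exact hv0 (hK l v (hVK hv) h)
  · obtain ⟨φ, hφe, hφ⟩ := Submodule.exists_le_ker_of_notMem heV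
    let T' : Module.End ℂ E := T - (LinearMap.toSpanSingleton ℂ E ((φ e)⁻¹ • e)) ∘ₗ φ ∘ₗ T
    refine (Module.End.finite_hasEigenvalue T').subset ?_
    rintro l ⟨v, hv, hl⟩
    have hvV : v ∈ V := Submodule.subset_span ⟨hv, l, hl⟩
    have hφv : φ v = 0 := hφ hvV
    apply Module.End.hasEigenvalue_of_hasEigenvector (x := v)
    refine ⟨Module.End.mem_eigenspace_iff.2 ?_, ?_⟩
    · simp only [T', LinearMap.sub_apply, LinearMap.comp_apply, hl, map_sub, map_smul, hφv,
        LinearMap.toSpanSingleton_apply]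
      simp [smul_smul, hφe]
    · rintro rfl
      simp at hl
      exact he hl

lemma finite_bad_matrix {X U : Type*} [Fintype X] [DecidableEq X]
    (A : Matrix X X ℝ) (B : Matrix X U ℝ) (S : Set X) (h : PBHOn A B S) (j : X) :
    {l : ℂ | ∃ v : X → ℂ, (∀ i, i ∉ S → v i = 0) ∧
      (∀ m, ∑ i, v i * (A i m : ℂ) = l * v m - (if m = j then 1 else 0)) ∧
      (∀ k, ∑ i, v i * (B i k : ℂ) = 0)}.Finite := by
  let T : Module.End ℂ (X → ℂ) := (A.map (algebraMap ℝ ℂ)).vecMulLinear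
  have hT : ∀ v m, T v m = ∑ i, v i * (A i m : ℂ) := by
    intro v m
    simp [T, Matrix.vecMul, dotProduct]
  let K : Submodule ℂ (X → ℂ) :=
    { carrier := {v | (∀ i, i ∉ S → v i = 0) ∧ (∀ k, ∑ i, v i * (B i k : ℂ) = 0)}
      add_mem' := by
        rintro a b ⟨h1, h2⟩ ⟨h3, h4⟩
        refine ⟨fun i hi => by simp [h1 i hi, h3 i hi], fun k => ?_⟩
        simp [add_mul, Finset.sum_add_distrib, h2, h4]
      zero_mem' := by simp
      smul_mem' := by
        rintro c a ⟨h1, h2⟩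
        refine ⟨fun i hi => by simp [h1 i hi], fun k => ?_⟩
        simp [mul_assoc, ← Finset.mul_sum, h2] }
  have := finite_bad T K (fun l v hv hl => h l v hv.1 (fun m => by
    rw [← hT, hl]; simp) hv.2) (Pi.single j 1) (by simp)
  refine this.subset ?_
  rintro l ⟨v, h1, h2, h3⟩
  refine ⟨v, ⟨h1, h3⟩, ?_⟩
  ext m
  rw [hT, h2]
  simp [Pi.single_apply]

lemma finite_spec {X : Type*} [Fintype X] [DecidableEq X] (A : Matrix X X ℝ) :
    {l : ℂ | ∃ v : X → ℂ, v ≠ 0 ∧ (∀ m, ∑ i, v i * (A i m : ℂ) = l * v m)}.Finite := by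
  let T : Module.End ℂ (X → ℂ) := (A.map (algebraMap ℝ ℂ)).vecMulLinear
  have hT : ∀ v m, T v m = ∑ i, v i * (A i m : ℂ) := by
    intro v m
    simp [T, Matrix.vecMul, dotProduct]
  refine (Module.End.finite_hasEigenvalue T).subset ?_
  rintro l ⟨v, hv, h⟩
  apply Module.End.hasEigenvalue_of_hasEigenvector (x := v)
  refine ⟨Module.End.mem_eigenspace_iff.2 ?_, hv⟩
  ext m
  rw [hT, h]; simp

lemma controllable_iff {X U : Type*} [Fintype X] [DecidableEq X] [Fintype U]
    (A : Matrix X X ℝ) (B : Matrix X U ℝ) :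
    Controllable A B ↔ ∀ v : X → ℝ,
      (∀ k < Fintype.card X, v ᵥ* (A ^ k * B) = 0) → v = 0 := by
  unfold Controllable
  rw [Matrix.rank_eq_finrank_span_row, eq_comm]
  have h1 := linearIndependent_iff_card_eq_finrank_span (R := ℝ) (b := (ctrbMatrix A B).row)
  rw [Set.finrank] at h1
  rw [← h1, Fintype.linearIndependent_iff]
  have key : ∀ v : X → ℝ, (∑ i, v i • (ctrbMatrix A B).row i = 0) ↔
      (∀ k < Fintype.card X, v ᵥ* (A ^ k * B) = 0) := by
    intro v
    constructor
    · intro h k hk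
      ext u
      have := congrFun h (⟨k, hk⟩, u)
      simpa [Matrix.vecMul, dotProduct, Matrix.row, ctrbMatrix] using this
    · intro h
      ext ⟨k, u⟩
      have := congrFun (h k k.2) u
      simpa [Matrix.vecMul, dotProduct, Matrix.row, ctrbMatrix] using this
  constructor
  · intro h v hv
    funext i
    exact h v ((key v).2 hv) i
  · intro h v hv i
    rw [h v ((key v).1 hv)]; rfl

lemma vecMul_pow_all {X U : Type*} [Fintype X] [DecidableEq X] [Fintype U]
    (A : Matrix X X ℝ) (B : Matrix X U ℝ) (v : X → ℝ)
    (h : ∀ k < Fintype.card X, v ᵥ* (A ^ k * B) = 0) (k : ℕ) : v ᵥ* (A ^ k * B) = 0 := by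
  rcases isEmpty_or_nonempty X with hX | hX
  · ext u; simp [Matrix.vecMul, dotProduct]
  have hd : (Polynomial.X ^ k %ₘ A.charpoly).natDegree < Fintype.card X := by
    rw [← Matrix.charpoly_natDegree_eq_dim A]
    apply Polynomial.natDegree_modByMonic_lt _ (Matrix.charpoly_monic A)
    intro h1
    have := Matrix.charpoly_natDegree_eq_dim A
    rw [h1] at this
    simp at this
    exact Fintype.card_ne_zero this.symm
  rw [Matrix.pow_eq_aeval_mod_charpoly, Polynomial.aeval_eq_sum_range, Matrix.sum_mul,
    ← Matrix.vecMulBilin_apply ℝ ℝ, map_sum]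
  refine Finset.sum_eq_zero fun m hm => ?_
  rw [Matrix.smul_mul, map_smul, Matrix.vecMulBilin_apply, h m (by
    have := Finset.mem_range.1 hm; omega), smul_zero]

lemma controllable_of_PBH {X U : Type*} [Fintype X] [DecidableEq X] [Fintype U]
    (A : Matrix X X ℝ) (B : Matrix X U ℝ) (h : PBHOn A B Set.univ) : Controllable A B := by
  rw [controllable_iff]
  intro v hv
  have hall := vecMul_pow_all A B v hv
  by_contra hv0
  let A' : Matrix X X ℂ := A.map (algebraMap ℝ ℂ)
  let B' : Matrix X U ℂ := B.map (algebraMap ℝ ℂ)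
  let T : Module.End ℂ (X → ℂ) := A'.vecMulLinear
  let V : Submodule ℂ (X → ℂ) := ⨅ k : ℕ, LinearMap.ker ((A' ^ k * B').vecMulLinear)
  have hmem : ∀ w, w ∈ V ↔ ∀ k, w ᵥ* (A' ^ k * B') = 0 := by
    intro w; simp [V, Submodule.mem_iInf]
  have hw : (fun i => (v i : ℂ)) ∈ V := by
    rw [hmem]
    intro k
    have h1 : A' ^ k * B' = (A ^ k * B).map (algebraMap ℝ ℂ) := by
      rw [Matrix.map_mul, Matrix.map_pow]
    rw [h1]
    ext u
    have := congrArg (algebraMap ℝ ℂ) (congrFun (hall k) u)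
    simpa [Matrix.vecMul, dotProduct] using this
  obtain ⟨l, w, hwV, hw0, hl⟩ := exists_eigvec_of_invariant T V (by
    intro w hw
    rw [hmem] at hw ⊢
    intro k
    have := hw (k + 1)
    simp only [T, Matrix.vecMulLinear_apply]
    rwa [Matrix.vecMul_vecMul, ← Matrix.mul_assoc, ← pow_succ']) _ hw (by
      intro h0
      apply hv0
      funext i
      simpa using congrFun h0 i)
  apply hw0
  refine h l w (by simp) ?_ ?_
  · intro j
    have := congrFun hl j
    simpa [T, A', Matrix.vecMul, dotProduct] using this
  · intro k
    have := congrFun ((hmem w).1 hwV 0) k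
    simpa [B', Matrix.vecMul, dotProduct] using this

/-- Perturbation to the exact sparsity pattern. -/
lemma structControllable_of_sub {X U : Type*} [Fintype X] [DecidableEq X] [Fintype U]
    (Ab : Matrix X X Bool) (Bb : Matrix X U Bool) (A : Matrix X X ℝ) (B : Matrix X U ℝ)
    (hA : ∀ i j, A i j ≠ 0 → Ab i j = true) (hB : ∀ i j, B i j ≠ 0 → Bb i j = true)
    (h : Controllable A B) : StructurallyControllable Ab Bb := by
  let At : ℝ → Matrix X X ℝ := fun t => Matrix.of fun i j => A i j + (if Ab i j = true then t else 0)
  let Bt : ℝ → Matrix X U ℝ := fun t => Matrix.of fun i j => B i j + (if Bb i j = true then t else 0)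
  have hAt : Continuous At := by
    refine continuous_matrix fun i j => ?_
    simp only [At, Matrix.of_apply]
    split_ifs <;> fun_prop
  have hBt : Continuous Bt := by
    refine continuous_matrix fun i j => ?_
    simp only [Bt, Matrix.of_apply]
    split_ifs <;> fun_prop
  have hA0 : At 0 = A := by ext i j; simp [At]
  have hB0 : Bt 0 = B := by ext i j; simp [Bt]
  let C : ℝ → Matrix X (Fin (Fintype.card X) × U) ℝ := fun t => ctrbMatrix (At t) (Bt t)
  have hC : Continuous C := by
    refine continuous_matrix fun i j => ?_
    exact ((hAt.pow _).matrix_mul hBt).matrix_elem i j.2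
  have hdet : Continuous fun t => (C t * (C t)ᵀ).det :=
    (hC.matrix_mul hC.matrix_transpose).matrix_det
  have h0 : (C 0 * (C 0)ᵀ).det ≠ 0 := by
    have h1 : (C 0 * (C 0)ᵀ).rank = Fintype.card X := by
      rw [Matrix.rank_self_mul_transpose]
      simp only [C, hA0, hB0]
      exact h
    intro h2
    obtain ⟨v, hv, hv0⟩ := Matrix.exists_mulVec_eq_zero_iff.2 h2
    have h3 := LinearMap.finrank_range_add_finrank_ker (C 0 * (C 0)ᵀ).mulVecLin
    have h4 : Module.finrank ℝ (LinearMap.range (C 0 * (C 0)ᵀ).mulVecLin) = Fintype.card X := h1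
    rw [h4, Module.finrank_fintype_fun_eq_card] at h3
    have h5 : Module.finrank ℝ (LinearMap.ker (C 0 * (C 0)ᵀ).mulVecLin) = 0 := by omega
    rw [Submodule.finrank_eq_zero] at h5
    have : v ∈ LinearMap.ker (C 0 * (C 0)ᵀ).mulVecLin := by
      rw [LinearMap.mem_ker, Matrix.mulVecLin_apply]; exact hv0
    rw [h5] at this
    exact hv (by simpa using this)
  have ev1 : ∀ᶠ t in nhdsWithin (0 : ℝ) {0}ᶜ, (C t * (C t)ᵀ).det ≠ 0 :=
    (hdet.continuousAt.eventually_ne h0).filter_mono nhdsWithin_le_nhds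
  have aux : ∀ (a : ℝ) (b : Bool), (a ≠ 0 → b = true) →
      ∀ᶠ t in nhdsWithin (0 : ℝ) {0}ᶜ, (a + (if b = true then t else 0) = 0 ↔ b = false) := by
    intro a b hab
    cases b
    · have : a = 0 := by by_contra h; simpa using hab h
      simp [this]
    · by_cases ha : a = 0
      · filter_upwards [self_mem_nhdsWithin] with t ht
        simpa [ha] using ht
      · have hc : ContinuousAt (fun t : ℝ => a + t) 0 := by fun_prop
        have h6 : ∀ᶠ t in nhds (0 : ℝ), a + t ≠ 0 := hc.eventually_ne (by simpa using ha)
        filter_upwards [h6.filter_mono nhdsWithin_le_nhds] with t ht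
        simpa using ht
  have ev2 : ∀ᶠ t in nhdsWithin (0 : ℝ) {0}ᶜ, SameSparsity (At t) Ab := by
    unfold SameSparsity
    rw [Filter.eventually_all]; intro i
    rw [Filter.eventually_all]; intro j
    exact aux _ _ (hA i j)
  have ev3 : ∀ᶠ t in nhdsWithin (0 : ℝ) {0}ᶜ, SameSparsity (Bt t) Bb := by
    unfold SameSparsity
    rw [Filter.eventually_all]; intro i
    rw [Filter.eventually_all]; intro j
    exact aux _ _ (hB i j)
  obtain ⟨t, h1, h2, h3⟩ := (ev1.and (ev2.and ev3)).exists
  refine ⟨At t, Bt t, h2, h3, ?_⟩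
  unfold Controllable
  rw [← Matrix.rank_self_mul_transpose]
  exact Matrix.rank_of_det_ne_zero h1

lemma reachable_of_controllable {X U : Type*} [Fintype X] [DecidableEq X] [Fintype U]
    (Ab : Matrix X X Bool) (Bb : Matrix X U Bool) (A : Matrix X X ℝ) (B : Matrix X U ℝ)
    (hA : SameSparsity A Ab) (hB : SameSparsity B Bb) (h : Controllable A B) (x : X) :
    InputReachable Ab Bb x := by
  by_contra hx
  have key : ∀ (k : ℕ) (i : X), ¬ InputReachable Ab Bb i → ∀ u, (A ^ k * B) i u = 0 := by
    intro k
    induction k with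
    | zero =>
      intro i hi u
      rw [pow_zero, Matrix.one_mul, hB i u]
      by_contra hb
      exact hi ⟨u, Relation.ReflTransGen.single (by simpa [sysDigraphRel] using hb)⟩
    | succ k ih =>
      intro i hi u
      rw [pow_succ', Matrix.mul_assoc, Matrix.mul_apply]
      refine Finset.sum_eq_zero fun j _ => ?_
      by_cases hj : InputReachable Ab Bb j
      · have : A i j = 0 := by
          rw [hA i j]
          by_contra hb
          obtain ⟨u', hu'⟩ := hj
          exact hi ⟨u', hu'.tail (by simpa [sysDigraphRel] using hb)⟩
        rw [this, zero_mul]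
      · rw [ih j hj, mul_zero]
  rw [controllable_iff] at h
  have := h (Pi.single x 1) (by
    intro k _
    ext u
    rw [Matrix.single_one_vecMul]
    exact key k x hx u)
  simpa using congrFun this x

lemma matching_of_controllable {X U : Type*} [Fintype X] [DecidableEq X] [Fintype U]
    [DecidableEq U]
    (Ab : Matrix X X Bool) (Bb : Matrix X U Bool) (A : Matrix X X ℝ) (B : Matrix X U ℝ)
    (hA : SameSparsity A Ab) (hB : SameSparsity B Bb) (h : Controllable A B) :
    ∃ f : X → X ⊕ U, Function.Injective f ∧ ∀ i, sysBipEdge Ab Bb (f i) i := by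
  classical
  rw [controllable_iff] at h
  let R : X → X ⊕ U → ℝ := fun i => Sum.elim (A i) (B i)
  have hR : ∀ v : X → ℝ, (∀ y, ∑ i, v i * R i y = 0) → v = 0 := by
    intro v hv
    apply h v
    intro k _
    cases k with
    | zero =>
      ext u
      simpa [Matrix.vecMul, dotProduct, R] using hv (Sum.inr u)
    | succ k =>
      have : v ᵥ* A = 0 := by
        ext j
        simpa [Matrix.vecMul, dotProduct, R] using hv (Sum.inl j)
      rw [pow_succ', Matrix.mul_assoc, ← Matrix.vecMul_vecMul, this, Matrix.zero_vecMul]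
  let t : X → Finset (X ⊕ U) := fun i => Finset.univ.filter fun y => R i y ≠ 0
  obtain ⟨f, hf, hft⟩ := (Finset.all_card_le_biUnion_card_iff_exists_injective t).1 (by
    intro s
    let F : s → (s.biUnion t → ℝ) := fun i y => R i y
    have hF : LinearIndependent ℝ F := by
      rw [Fintype.linearIndependent_iff]
      intro g hg
      let v : X → ℝ := fun i => if hi : i ∈ s then g ⟨i, hi⟩ else 0
      have hv : v = 0 := by
        apply hR
        intro y
        have h1 : ∑ i, v i * R i y = ∑ i : s, g i * R i y := by
          rw [← Finset.sum_subset (Finset.subset_univ s), ← Finset.sum_coe_sort s]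
          · refine Finset.sum_congr rfl fun i _ => ?_
            simp [v]
          · intro i _ hi
            simp [v, hi]
        rw [h1]
        by_cases hy : y ∈ s.biUnion t
        · have := congrFun hg ⟨y, hy⟩
          simpa [F] using this
        · refine Finset.sum_eq_zero fun i _ => ?_
          have : R i y = 0 := by
            by_contra h0
            exact hy (Finset.mem_biUnion.2 ⟨i, i.2, by simpa [t] using h0⟩)
          rw [this, mul_zero]
      intro i
      have := congrFun hv i
      simpa [v] using this
    have := hF.fintype_card_le_finrank
    rw [Module.finrank_fintype_fun_eq_card, Fintype.card_coe, Fintype.card_coe] at this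
    exact this)
  refine ⟨f, hf, fun i => ?_⟩
  have := hft i
  simp only [t, Finset.mem_filter, Finset.mem_univ, true_and] at this
  cases hfi : f i with
  | inl j =>
    rw [hfi] at this
    have h2 : A i j ≠ 0 := this
    rw [Ne, hA i j] at h2
    simpa [sysBipEdge] using h2
  | inr u =>
    rw [hfi] at this
    have h2 : B i u ≠ 0 := this
    rw [Ne, hB i u] at h2
    simpa [sysBipEdge] using h2

/-- Induction invariant: the states in `S` can be controlled by a subpattern living on `S`. -/
def GoodSet {X U : Type*} [Fintype X] (Ab : Matrix X X Bool) (Bb : Matrix X U Bool)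
    (f : X → X ⊕ U) (S : Set X) : Prop :=
  (∀ i, i ∉ S → ∃ j, j ∉ S ∧ f i = Sum.inl j) ∧
  ∃ (A : Matrix X X ℝ) (B : Matrix X U ℝ),
    (∀ i j, A i j ≠ 0 → Ab i j = true ∧ i ∈ S ∧ j ∈ S) ∧
    (∀ i k, B i k ≠ 0 → Bb i k = true ∧ i ∈ S) ∧ PBHOn A B S

/-- States on matching paths starting at an input. -/
inductive PathState {X U : Type*} (f : X → X ⊕ U) : X → Prop
  | base (i : X) (u : U) (h : f i = Sum.inr u) : PathState f i
  | step (i j : X) (h : f i = Sum.inl j) (hj : PathState f j) : PathState f i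

lemma goodSet_base {X U : Type*} [Fintype X] (Ab : Matrix X X Bool) (Bb : Matrix X U Bool)
    (f : X → X ⊕ U) (hf : Function.Injective f) (hE : ∀ i, sysBipEdge Ab Bb (f i) i) :
    GoodSet Ab Bb f {i | PathState f i} := by
  classical
  refine ⟨?_, ?_⟩
  · intro i hi
    cases h : f i with
    | inl j => exact ⟨j, fun hj => hi (PathState.step i j h hj), rfl⟩
    | inr u => exact absurd (PathState.base i u h) hi
  refine ⟨fun i j => if PathState f j ∧ f i = Sum.inl j then 1 else 0,
    fun i k => if f i = Sum.inr k then 1 else 0, ?_, ?_, ?_⟩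
  · intro i j h
    have h1 : PathState f j ∧ f i = Sum.inl j := by
      by_contra h2
      simp [h2] at h
    refine ⟨?_, PathState.step i j h1.2 h1.1, h1.1⟩
    have := hE i
    rw [h1.2] at this
    exact this
  · intro i k h
    have h1 : f i = Sum.inr k := by
      by_contra h2
      simp [h2] at h
    refine ⟨?_, PathState.base i k h1⟩
    have := hE i
    rw [h1] at this
    exact this
  · intro l v hv hA hB
    funext i
    by_cases hi : PathState f i
    · induction hi with
      | base i u h =>
        have := hB u
        rw [Finset.sum_eq_single i] at this
        · simpa [h] using this
        · intro b _ hb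
          have : f b ≠ Sum.inr u := fun h' => hb (hf (h'.trans h.symm))
          simp [this]
        · simp
      | step i j h hj ih =>
        have := hA j
        rw [Finset.sum_eq_single i] at this
        · simpa [h, hj, ih] using this
        · intro b _ hb
          have : f b ≠ Sum.inl j := fun h' => hb (hf (h'.trans h.symm))
          simp [this]
        · simp
    · exact hv i hi

lemma goodSet_step {X U : Type*} [Fintype X] (Ab : Matrix X X Bool) (Bb : Matrix X U Bool)
    (f : X → X ⊕ U) (hf : Function.Injective f) (hE : ∀ i, sysBipEdge Ab Bb (f i) i)
    (S : Set X) (hS : ∀ i, i ∉ S → ∃ j, j ∉ S ∧ f i = Sum.inl j)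
    (A : Matrix X X ℝ) (B : Matrix X U ℝ)
    (hA : ∀ i j, A i j ≠ 0 → Ab i j = true ∧ i ∈ S ∧ j ∈ S)
    (hB : ∀ i k, B i k ≠ 0 → Bb i k = true ∧ i ∈ S) (hP : PBHOn A B S)
    (x : X) (hx : x ∉ S) (e : X → ℝ) (g : U → ℝ)
    (he : ∀ j, e j ≠ 0 → Ab x j = true ∧ j ∈ S) (hg : ∀ k, g k ≠ 0 → Bb x k = true)
    (F : Set ℂ) (hF : F.Finite)
    (hFbad : ∀ l ∉ F, ∀ (w : X → ℂ) (a : ℂ), a ≠ 0 → (∀ i, i ∉ S → w i = 0) →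
      (∀ j, ∑ i, w i * (A i j : ℂ) + a * (e j : ℂ) = l * w j) →
      (∀ k, ∑ i, w i * (B i k : ℂ) + a * (g k : ℂ) = 0) → False) :
    ∃ S', S ⊂ S' ∧ GoodSet Ab Bb f S' := by
  classical
  obtain ⟨c, hc0, hcF⟩ : ∃ c : ℝ, 0 < c ∧ ∀ l ∈ F, ‖l‖ ≠ c := by
    have h1 : ((fun l : ℂ => ‖l‖) '' F).Finite := hF.image _
    obtain ⟨c, hc, hc'⟩ := (Set.Ioi_infinite (0 : ℝ)).exists_notMem_finite h1
    exact ⟨c, hc, fun l hl h => hc' ⟨l, hl, h⟩⟩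
  have hS' : ∀ i, ∃ j, i ∉ S → j ∉ S ∧ f i = Sum.inl j := by
    intro i
    by_cases hi : i ∈ S
    · exact ⟨i, fun h => absurd hi h⟩
    · obtain ⟨j, hj⟩ := hS i hi
      exact ⟨j, fun _ => hj⟩
  choose nxt hnxt using hS'
  let C : Finset X := Finset.univ.filter fun y => ∃ m : ℕ, nxt^[m] x = y
  have hCmem : ∀ y, y ∈ C ↔ ∃ m : ℕ, nxt^[m] x = y := by intro y; simp [C]
  have hxC : x ∈ C := (hCmem x).2 ⟨0, rfl⟩
  have hCn : ∀ y ∈ C, nxt y ∈ C := by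
    intro y hy
    obtain ⟨m, rfl⟩ := (hCmem y).1 hy
    exact (hCmem _).2 ⟨m + 1, Function.iterate_succ_apply' _ _ _⟩
  have hCS : ∀ y ∈ C, y ∉ S := by
    intro y hy
    obtain ⟨m, rfl⟩ := (hCmem y).1 hy
    clear hy
    induction m with
    | zero => exact hx
    | succ m ih => rw [Function.iterate_succ_apply']; exact (hnxt _ ih).1
  have hfn : ∀ y, y ∉ S → f y = Sum.inl (nxt y) := fun y hy => (hnxt y hy).2
  have hinj : ∀ y z, y ∉ S → z ∉ S → nxt y = nxt z → y = z := by
    intro y z hy hz h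
    apply hf
    rw [hfn y hy, hfn z hz, h]
  have himg : C.image nxt = C := by
    apply Finset.eq_of_subset_of_card_le
    · intro y hy
      obtain ⟨z, hz, rfl⟩ := Finset.mem_image.1 hy
      exact hCn z hz
    · rw [Finset.card_image_of_injOn]
      intro y hy z hz h
      exact hinj y z (hCS y hy) (hCS z hz) h
  refine ⟨S ∪ C, ?_, ?_, ?_⟩
  · refine ⟨Set.subset_union_left, fun h => hx (h (Or.inr hxC))⟩
  · intro i hi
    have hiS : i ∉ S := fun h => hi (Or.inl h)
    have hiC : i ∉ C := fun h => hi (Or.inr h)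
    refine ⟨nxt i, ?_, hfn i hiS⟩
    rintro (h | h)
    · exact (hnxt i hiS).1 h
    · have h' : nxt i ∈ C.image nxt := by rw [himg]; exact h
      obtain ⟨z, hz, hzi⟩ := Finset.mem_image.1 h'
      exact hiC (hinj z i (hCS z hz) hiS hzi ▸ hz)
  refine ⟨fun i j => A i j + (if i ∈ C ∧ f i = Sum.inl j then c else 0) + (if i = x then e j else 0),
    fun i k => B i k + (if i = x then g k else 0), ?_, ?_, ?_⟩
  · intro i j h
    by_cases h1 : A i j = 0
    · by_cases h2 : i ∈ C ∧ f i = Sum.inl j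
      · refine ⟨?_, Or.inr h2.1, Or.inr ?_⟩
        · have := hE i
          rw [h2.2] at this
          exact this
        · have := hfn i (hCS i h2.1)
          rw [h2.2] at this
          rw [Sum.inl.inj this]
          exact hCn i h2.1
      · by_cases h3 : i = x
        · subst h3
          have h4 : e j ≠ 0 := by
            intro h4
            simp [h1, h2, h4] at h
          exact ⟨(he j h4).1, Or.inr hxC, Or.inl (he j h4).2⟩
        · simp [h1, h2, h3] at h
    · have := hA i j h1
      exact ⟨this.1, Or.inl this.2.1, Or.inl this.2.2⟩
  · intro i k h
    by_cases h1 : B i k = 0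
    · by_cases h3 : i = x
      · subst h3
        have h4 : g k ≠ 0 := by
          intro h4
          simp [h1, h4] at h
        exact ⟨hg k h4, Or.inr hxC⟩
      · simp [h1, h3] at h
    · have := hB i k h1
      exact ⟨this.1, Or.inl this.2⟩
  · intro l v hv hvA hvB
    let w : X → ℂ := fun i => if i ∈ S then v i else 0
    have hwS : ∀ i, i ∉ S → w i = 0 := fun i hi => by simp [w, hi]
    have hwA : ∀ j, ∑ i, v i * (A i j : ℂ) = ∑ i, w i * (A i j : ℂ) := by
      intro j
      refine Finset.sum_congr rfl fun i _ => ?_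
      by_cases hi : i ∈ S
      · simp [w, hi]
      · have : A i j = 0 := by by_contra h; exact hi (hA i j h).2.1
        simp [this]
    have hwB : ∀ j, ∑ i, v i * (B i j : ℂ) = ∑ i, w i * (B i j : ℂ) := by
      intro j
      refine Finset.sum_congr rfl fun i _ => ?_
      by_cases hi : i ∈ S
      · simp [w, hi]
      · have : B i j = 0 := by by_contra h; exact hi (hB i j h).2
        simp [this]
    have eqA : ∀ j, ∑ i, w i * (A i j : ℂ) +
        ∑ i, v i * (if i ∈ C ∧ f i = Sum.inl j then (c : ℂ) else 0) + v x * (e j : ℂ) = l * v j := by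
      intro j
      rw [← hvA j, ← hwA j]
      have h1 : v x * (e j : ℂ) = ∑ i, v i * (if i = x then (e j : ℂ) else 0) := by simp
      rw [h1, ← Finset.sum_add_distrib, ← Finset.sum_add_distrib]
      refine Finset.sum_congr rfl fun i _ => ?_
      dsimp only
      split_ifs <;> push_cast <;> ring
    have eqB : ∀ k, ∑ i, w i * (B i k : ℂ) + v x * (g k : ℂ) = 0 := by
      intro k
      rw [← hvB k, ← hwB k]
      have h1 : v x * (g k : ℂ) = ∑ i, v i * (if i = x then (g k : ℂ) else 0) := by simp
      rw [h1, ← Finset.sum_add_distrib]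
      refine Finset.sum_congr rfl fun i _ => ?_
      dsimp only
      split_ifs <;> push_cast <;> ring
    have eqS : ∀ j, ∑ i, w i * (A i j : ℂ) + v x * (e j : ℂ) = l * w j := by
      intro j
      by_cases hj : j ∈ S
      · have h1 := eqA j
        rw [Finset.sum_eq_zero (f := fun i => v i * (if i ∈ C ∧ f i = Sum.inl j then (c : ℂ) else 0)),
          add_zero] at h1
        · simpa [w, hj] using h1
        · intro i _
          rw [if_neg, mul_zero]
          rintro ⟨h2, h3⟩
          have := hnxt i (hCS i h2)
          rw [h3] at this
          exact this.1 (Sum.inl.inj this.2 ▸ hj)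
      · have h1 : e j = 0 := by by_contra h; exact hj (he j h).2
        have h2 : ∀ i, A i j = 0 := fun i => by by_contra h; exact hj (hA i j h).2.2
        simp [h1, h2, hwS j hj]
    have eqC : ∀ i ∈ C, v i * c = l * v (nxt i) := by
      intro i hi
      have hn := (hnxt i (hCS i hi)).1
      have h1 : e (nxt i) = 0 := by by_contra h; exact hn (he _ h).2
      have h2 : ∀ m, A m (nxt i) = 0 := fun m => by by_contra h; exact hn (hA m _ h).2.2
      have h3 := eqA (nxt i)
      rw [Finset.sum_eq_single (f := fun m => v m * (if m ∈ C ∧ f m = Sum.inl (nxt i) then (c : ℂ) else 0)) i] at h3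
      · simpa [h1, h2, hi, hfn i (hCS i hi)] using h3
      · intro b _ hb
        rw [if_neg, mul_zero]
        rintro ⟨h4, h5⟩
        exact hb (hf (h5.trans (hfn i (hCS i hi)).symm))
      · simp
    have hcC : (c : ℂ) ≠ 0 := by exact_mod_cast hc0.ne'
    have hvx : v x = 0 := by
      by_contra hvx
      have hlF : l ∉ F := by
        intro hl
        apply hcF l hl
        have hsum : ∑ i ∈ C, ‖v (nxt i)‖ = ∑ i ∈ C, ‖v i‖ := by
          conv_rhs => rw [← himg]
          rw [Finset.sum_image]
          intro y hy z hz h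
          exact hinj y z (hCS y hy) (hCS z hz) h
        have hpos : 0 < ∑ i ∈ C, ‖v i‖ :=
          Finset.sum_pos' (fun _ _ => norm_nonneg _) ⟨x, hxC, norm_pos_iff.2 hvx⟩
        have : (∑ i ∈ C, ‖v i‖) * c = ‖l‖ * ∑ i ∈ C, ‖v i‖ := by
          conv_rhs => rw [← hsum]
          rw [Finset.sum_mul, Finset.mul_sum]
          refine Finset.sum_congr rfl fun i hi => ?_
          have := congrArg norm (eqC i hi)
          simpa [abs_of_pos hc0] using this
        have h2 : (∑ i ∈ C, ‖v i‖) * (‖l‖ - c) = 0 := by linarith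
        rcases mul_eq_zero.1 h2 with h3 | h3
        · exact absurd h3 hpos.ne'
        · linarith
      exact hFbad l hlF w (v x) hvx hwS eqS eqB
    have hw0 : w = 0 := by
      refine hP l w hwS ?_ ?_
      · intro j
        simpa [hvx] using eqS j
      · intro k
        simpa [hvx] using eqB k
    have hvC : ∀ i ∈ C, v i = 0 := by
      by_cases hl : l = 0
      · intro i hi
        have := eqC i hi
        rw [hl, zero_mul] at this
        exact (mul_eq_zero.1 this).resolve_right hcC
      · intro i hi
        obtain ⟨m, rfl⟩ := (hCmem i).1 hi
        clear hi
        induction m with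
        | zero => exact hvx
        | succ m ih =>
          have := eqC _ ((hCmem _).2 ⟨m, rfl⟩)
          rw [ih, zero_mul] at this
          rw [Function.iterate_succ_apply']
          exact (mul_eq_zero.1 this.symm).resolve_left hl
    funext i
    by_cases hi : i ∈ S
    · have := congrFun hw0 i
      simpa [w, hi] using this
    · by_cases hiC : i ∈ C
      · exact hvC i hiC
      · exact hv i (by rintro (h | h); exacts [hi h, hiC h])

lemma goodSet_extend {X U : Type*} [Fintype X] (Ab : Matrix X X Bool) (Bb : Matrix X U Bool)
    (f : X → X ⊕ U) (hf : Function.Injective f) (hE : ∀ i, sysBipEdge Ab Bb (f i) i)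
    (hreach : ∀ x, InputReachable Ab Bb x) (S : Set X) (hS : GoodSet Ab Bb f S)
    (hne : S ≠ Set.univ) : ∃ S', S ⊂ S' ∧ GoodSet Ab Bb f S' := by
  classical
  obtain ⟨hS1, A, B, hA, hB, hP⟩ := hS
  obtain ⟨y, hy⟩ := (Set.ne_univ_iff_exists_notMem S).1 hne
  have hex : ∃ x, x ∉ S ∧ ((∃ j ∈ S, Ab x j = true) ∨ ∃ u, Bb x u = true) := by
    by_contra hno
    push Not at hno
    obtain ⟨u, hu⟩ := hreach y
    have : ∀ z, Relation.ReflTransGen (sysDigraphRel Ab Bb) (Sum.inr u) z →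
        ∀ i, z = Sum.inl i → i ∈ S := by
      intro z hz
      induction hz with
      | refl => intro i hi; cases hi
      | @tail b d hab hbd ih =>
        rintro i rfl
        by_contra hi
        cases b with
        | inl j => exact (hno i hi).1 j (ih j rfl) hbd
        | inr k => exact (hno i hi).2 k hbd
    exact hy (this _ hu y rfl)
  obtain ⟨x, hx, ⟨j, hj, hxj⟩ | ⟨u, hu⟩⟩ := hex
  · refine goodSet_step Ab Bb f hf hE S hS1 A B hA hB hP x hx (Pi.single j 1) 0 ?_ ?_ _
      (finite_bad_matrix A B S hP j) ?_
    · intro m hm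
      have : m = j := by
        by_contra h
        simp [h] at hm
      subst this
      exact ⟨hxj, hj⟩
    · intro k hk
      simp at hk
    · intro l hl w a ha hw h1 h2
      apply hl
      refine ⟨fun i => a⁻¹ * w i, fun i hi => by simp [hw i hi], ?_, ?_⟩
      · intro m
        have := h1 m
        simp only [mul_assoc, ← Finset.mul_sum]
        rw [eq_sub_of_add_eq this]
        by_cases hm : m = j
        · subst hm
          simp only [Pi.single_eq_same, if_true]
          field_simp
          simp
        · simp [hm]; ring
      · intro k
        have := h2 k
        simp only [mul_assoc, ← Finset.mul_sum]
        simp at this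
        rw [this, mul_zero]
  · refine goodSet_step Ab Bb f hf hE S hS1 A B hA hB hP x hx 0 (Pi.single u 1) ?_ ?_ _
      (finite_spec A) ?_
    · intro m hm
      simp at hm
    · intro k hk
      have : k = u := by
        by_contra h
        simp [h] at hk
      subst this
      exact hu
    · intro l hl w a ha hw h1 h2
      have hw0 : w = 0 := by
        by_contra hw0
        exact hl ⟨w, hw0, fun m => by simpa using h1 m⟩
      have := h2 u
      simp [hw0] at this
      exact ha this

lemma goodSet_univ {X U : Type*} [Fintype X] (Ab : Matrix X X Bool) (Bb : Matrix X U Bool)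
    (f : X → X ⊕ U) (hf : Function.Injective f) (hE : ∀ i, sysBipEdge Ab Bb (f i) i)
    (hreach : ∀ x, InputReachable Ab Bb x) : GoodSet Ab Bb f Set.univ := by
  obtain ⟨S, hS⟩ := (Set.toFinite {S : Set X | GoodSet Ab Bb f S}).exists_maximal
    ⟨_, goodSet_base Ab Bb f hf hE⟩
  by_cases h : S = Set.univ
  · exact h ▸ hS.1
  · obtain ⟨S', hlt, hS'⟩ := goodSet_extend Ab Bb f hf hE hreach S hS.1 h
    exact absurd (hS.2 hS' hlt.1) hlt.2

/-- Theorem 3, (1) ⟺ (4), of the paper: a structural pair `(Ā, B̄)` is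
structurally controllable iff every state vertex of `D(Ā, B̄)` is input-reachable and the
system bipartite graph `B(Ā, B̄)` has a matching with no right-unmatched vertices. -/
theorem struct_controllable_iff_reachable_and_matching
    {n p : ℕ} (Ab : Matrix (Fin n) (Fin n) Bool) (Bb : Matrix (Fin n) (Fin p) Bool) :
    StructurallyControllable Ab Bb ↔
      ((∀ x : Fin n, InputReachable Ab Bb x) ∧
        ∃ M : Set ((Fin n ⊕ Fin p) × Fin n),
          IsMatching (sysBipEdge Ab Bb) M ∧ rightUnmatched M = ∅) := by

  constructor
  · rintro ⟨A, B, hA, hB, h⟩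
    refine ⟨reachable_of_controllable Ab Bb A B hA hB h, ?_⟩
    obtain ⟨f, hf, hE⟩ := matching_of_controllable Ab Bb A B hA hB h
    refine ⟨Set.range fun i => (f i, i), ⟨?_, ?_, ?_⟩, ?_⟩
    · rintro _ ⟨i, rfl⟩
      exact hE i
    · rintro _ ⟨i, rfl⟩ _ ⟨j, rfl⟩ h1
      rw [hf h1]
    · rintro _ ⟨i, rfl⟩ _ ⟨j, rfl⟩ h1
      rw [show i = j from h1]
    · ext b
      simp only [rightUnmatched, Set.mem_setOf_eq, Set.mem_empty_iff_false, iff_false]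
      intro h1
      exact h1 _ ⟨b, rfl⟩ rfl
  · rintro ⟨hreach, M, ⟨hM1, hM2, hM3⟩, hM⟩
    have hex : ∀ i, ∃ y, (y, i) ∈ M := by
      intro i
      have : i ∉ rightUnmatched M := by rw [hM]; simp
      simp only [rightUnmatched, Set.mem_setOf_eq] at this
      push Not at this
      obtain ⟨⟨y, b⟩, hy, rfl⟩ := this
      exact ⟨y, hy⟩
    choose f hfM using hex
    have hf : Function.Injective f := by
      intro i j hij
      exact congrArg Prod.snd (hM2 _ (hfM i) _ (hfM j) hij)
    obtain ⟨-, A, B, hA, hB, hP⟩ :=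
      goodSet_univ Ab Bb f hf (fun i => hM1 _ (hfM i)) hreach
    exact structControllable_of_sub Ab Bb A B (fun i j h => (hA i j h).1)
      (fun i j h => (hB i j h).1) (controllable_of_PBH A B hP)
end
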